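/- arXiv:2112.02703 — 2 statements merged into one kernel-verified Lean document; each statement's English description precedes it below -/
import Mathlib

section
/- Let D ∈ CD_{n,k} be a chord diagram containing a top chord (i, i+1, n−2, n−1), let C be a domino matrix of D satisfying the sign rules, let Z ∈ Mat_{n×(k+4)}(ℝ) be positive, and let Y = CZ. Then for every j ∈ {1,…,n−4} with j ≠ i: ⟨Y i j j+1 n⟩·⟨Y i+1 n−2 n−1 n⟩ − ⟨Y i+1 j j+1 n⟩·⟨Y i n−2 n−1 n⟩ < 0. -/
open scoped Classical

noncomputable section

/-- A rectangular `n × r` matrix (with `r ≤ n`) is *positive* if all of its maximal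
`r × r` minors (rows selected in increasing order) have positive determinant. -/
def IsPositiveMatrix {n r : ℕ} (Z : Matrix (Fin n) (Fin r) ℝ) : Prop :=
  ∀ f : Fin r → Fin n, StrictMono f → 0 < (Z.submatrix f id).det

/-- A `k × n` matrix is *totally nonnegative* if all of its `k × k` minors
(columns selected in increasing order) have nonnegative determinant. -/
def IsTotallyNonnegRect {k n : ℕ} (C : Matrix (Fin k) (Fin n) ℝ) : Prop :=
  ∀ g : Fin k → Fin n, StrictMono g → 0 ≤ (C.submatrix id g).det

/-- The row of `Z` whose (1-based) marker is `p`, i.e. the row with index `p - 1`. -/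
def markerRow {n r : ℕ} (Z : Matrix (Fin n) (Fin r) ℝ) (p : ℕ) : Fin r → ℝ :=
  if h : p - 1 < n then Z ⟨p - 1, h⟩ else 0

/-- The twistor coordinate `⟨Y a₁ a₂ a₃ a₄⟩`: the determinant of the `(k+4) × (k+4)` matrix
whose rows are the `k` rows of `Y` followed by the rows of `Z` with (1-based) markers
`a 0, a 1, a 2, a 3`. -/
def twistor {n k : ℕ} (Z : Matrix (Fin n) (Fin (k + 4)) ℝ)
    (Y : Matrix (Fin k) (Fin (k + 4)) ℝ) (a : Fin 4 → ℕ) : ℝ :=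
  ((Matrix.fromRows Y (Matrix.of fun t => markerRow Z (a t))).submatrix
    (⇑finSumFinEquiv.symm) id).det

/-- The row space of a matrix: the span of its rows. -/
def rowSpace {k n : ℕ} (A : Matrix (Fin k) (Fin n) ℝ) : Submodule ℝ (Fin n → ℝ) :=
  Submodule.span ℝ (Set.range fun r => A r)

/-- The minor of `A` on the set of rows `S` (taken in increasing order), using all columns;
defined to be `0` if `S` does not have the right cardinality. -/
def rowMinor {N r : ℕ} (A : Matrix (Fin N) (Fin r) ℝ) (S : Finset (Fin N)) : ℝ :=
  if h : S.card = r then (A.submatrix (fun t => (S.orderIsoOfFin h t).1) id).det else 0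

/-- The minor of `C` on the set of columns `J` (taken in increasing order), using all rows;
defined to be `0` if `J` does not have the right cardinality. -/
def colMinor {k N : ℕ} (C : Matrix (Fin k) (Fin N) ℝ) (J : Finset (Fin N)) : ℝ :=
  if h : J.card = k then (C.submatrix id (fun t => (J.orderIsoOfFin h t).1)).det else 0


/-- A chord diagram with `n` markers (labelled `1, …, n`) and `k` chords
`c_l = (tail l, tail l + 1, head l, head l + 1)`. -/
structure ChordDiagram (n k : ℕ) where
  tail : Fin k → ℕ
  head : Fin k → ℕ
  one_le_tail : ∀ l, 1 ≤ tail l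
  tail_add_two_le_head : ∀ l, tail l + 2 ≤ head l
  head_add_two_le : ∀ l, head l + 2 ≤ n
  tail_strictMono : StrictMono tail
  noncrossing : ∀ l m : Fin k, l < m → ¬(tail m < head l ∧ head l < head m)

namespace ChordDiagram

variable {n k : ℕ} (D : ChordDiagram n k)

/-- `c_m` is a descendant of `c_l`. -/
def Descendant (l m : Fin k) : Prop := D.tail l < D.tail m ∧ D.head m ≤ D.head l

/-- The number of descendants of `c_l`. -/
def below (l : Fin k) : ℕ := (Finset.univ.filter fun m => D.Descendant l m).card

/-- `c_l` is a top chord: it has no ancestor. -/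
def IsTop (l : Fin k) : Prop := ∀ m, ¬ D.Descendant m l

/-- `c_m` is the parent of `c_l`: the ancestor of `c_l` with the largest start. -/
def IsParent (m l : Fin k) : Prop :=
  D.Descendant m l ∧ ∀ m', D.Descendant m' l → D.tail m' ≤ D.tail m

/-- The number of chords starting after the start of `c_l` (equals `k - l` for the
`l`-th chord in the 1-based start-increasing ordering). -/
def behind (l : Fin k) : ℕ := (Finset.univ.filter fun m => D.tail l < D.tail m).card

/-- The number of descendants of `c_m` (the parent of `c_l`) that come before `c_l`
(equals `l - m - 1` in the 1-based start-increasing ordering). -/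
def beyond (l m : Fin k) : ℕ :=
  (Finset.univ.filter fun h => D.Descendant m h ∧ D.tail h < D.tail l).card

/-- The domino matrix of `D` with variables `α, β, γ, δ, ε` : the column with (0-based)
index `a` corresponds to the (1-based) marker `a + 1`. -/
def dominoMatrix (α β γ δ ε : Fin k → ℝ) : Matrix (Fin k) (Fin n) ℝ :=
  Matrix.of fun l a =>
    (if (a : ℕ) + 1 = D.tail l then α l else 0) +
    (if (a : ℕ) + 1 = D.tail l + 1 then β l else 0) +
    (if (a : ℕ) + 1 = D.head l then γ l else 0) +
    (if (a : ℕ) + 1 = D.head l + 1 then δ l else 0) +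
    (if D.IsTop l ∧ (a : ℕ) + 1 = n then ε l else 0) +
    (∑ m : Fin k, if D.IsParent m l then
        (if (a : ℕ) + 1 = D.tail m then ε l * α m else 0) +
        (if (a : ℕ) + 1 = D.tail m + 1 then ε l * β m else 0)
      else 0)

/-- The sign rules for the domino variables of `D`. -/
def SignRules (α β γ δ ε : Fin k → ℝ) : Prop :=
  (∀ l, 0 < α l) ∧ (∀ l, 0 < β l) ∧
  (∀ l, 0 < (-1 : ℝ) ^ D.below l * γ l) ∧
  (∀ l, 0 < (-1 : ℝ) ^ D.below l * δ l) ∧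
  (∀ l, D.IsTop l → 0 < (-1 : ℝ) ^ D.behind l * ε l) ∧
  (∀ l m, D.IsParent m l → 0 < (-1 : ℝ) ^ D.beyond l m * ε l) ∧
  (∀ l m, D.IsParent m l → D.head l = D.head m → δ l / γ l < δ m / γ m) ∧
  (∀ l m, D.head m = D.tail l → δ m / γ m < β l / α l)

end ChordDiagram


/-! ### Nonnegative combinations of increasing products -/

theorem commute_pair_apply {A : Type*} [Ring A] {z : ℕ → A}
    (hz : ∀ a b, z a * z b = -(z b * z a)) (i j s : ℕ) : Commute (z i * z j) (z s) := by
  rw [Commute, SemiconjBy, mul_assoc, hz j s, mul_neg, ← mul_assoc, hz i s, neg_mul, neg_neg,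
    mul_assoc]

theorem commute_pair_prod {A : Type*} [Ring A] {z : ℕ → A}
    (hz : ∀ a b, z a * z b = -(z b * z a)) (i j : ℕ) (S : List ℕ) :
    Commute (z i * z j) (S.map z).prod :=
  Commute.list_prod_right _ _ fun x hx => by
    obtain ⟨s, -, rfl⟩ := List.mem_map.1 hx
    exact commute_pair_apply hz i j s

/-- Inserting two adjacent indices into an increasing product does not change its sign. -/
theorem prod_mul_pair {A : Type*} [Ring A] {z : ℕ → A}
    (hz : ∀ a b, z a * z b = -(z b * z a)) {S : List ℕ} (hS : S.Pairwise (· < ·))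
    {j : ℕ} (hj : j ∉ S)
    (hj' : j + 1 ∉ S) :
    ∃ T : List ℕ, T.Pairwise (· < ·) ∧ (∀ s, s ∈ T ↔ s ∈ S ∨ s = j ∨ s = j + 1) ∧
      T.length = S.length + 2 ∧ (S.map z).prod * (z j * z (j + 1)) = (T.map z).prod := by
  induction S with
  | nil => exact ⟨[j, j + 1], by simp, by simp, rfl, by simp⟩
  | cons a S ih =>
    rw [List.pairwise_cons] at hS
    rw [List.mem_cons, not_or] at hj hj'
    by_cases h : j < a
    · refine ⟨j :: (j + 1) :: a :: S, ?_, ?_, rfl, ?_⟩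
      · have h1 : j + 1 < a := by omega
        simp only [List.pairwise_cons, List.mem_cons, forall_eq_or_imp]
        exact ⟨⟨by omega, h, fun s hs => h.trans (hS.1 s hs)⟩,
          ⟨h1, fun s hs => h1.trans (hS.1 s hs)⟩, hS⟩
      · intro s
        simp only [List.mem_cons]
        tauto
      · rw [← (commute_pair_prod hz j (j + 1) (a :: S)).eq]
        simp [mul_assoc]
    · obtain ⟨T, hT, hmem, hlen, hprod⟩ := ih hS.2 hj.2 hj'.2
      refine ⟨a :: T, List.pairwise_cons.2 ⟨fun s hs => ?_, hT⟩, ?_, by simp [hlen], ?_⟩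
      · rcases (hmem s).1 hs with hs | rfl | rfl
        · exact hS.1 s hs
        · omega
        · omega
      · intro s
        simp only [List.mem_cons, hmem, or_assoc]
      · rw [List.map_cons, List.prod_cons, mul_assoc, hprod, List.map_cons, List.prod_cons]

section PosCone

variable {A : Type*} [Ring A] [Algebra ℝ A] {z : ℕ → A}

/-- The cone of nonnegative combinations of products `z s₁ * ⋯ * z sᵣ` with
`a ≤ s₁ < ⋯ < sᵣ ≤ b`. -/
def posCone (z : ℕ → A) (a b : ℕ) : AddSubmonoid A :=
  AddSubmonoid.closure {x | ∃ t : ℝ, 0 ≤ t ∧ ∃ S : List ℕ,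
    S.Pairwise (· < ·) ∧ (∀ s ∈ S, a ≤ s ∧ s ≤ b) ∧ x = t • (S.map z).prod}

theorem smul_prod_mem_posCone {a b : ℕ} {t : ℝ} (ht : 0 ≤ t) {S : List ℕ}
    (hS : S.Pairwise (· < ·)) (hab : ∀ s ∈ S, a ≤ s ∧ s ≤ b) :
    t • (S.map z).prod ∈ posCone z a b :=
  AddSubmonoid.subset_closure ⟨t, ht, S, hS, hab, rfl⟩

theorem prod_mem_posCone {a b : ℕ} {S : List ℕ}
    (hS : S.Pairwise (· < ·)) (hab : ∀ s ∈ S, a ≤ s ∧ s ≤ b) :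
    (S.map z).prod ∈ posCone z a b := by
  simpa using smul_prod_mem_posCone (z := z) zero_le_one hS hab

theorem posCone_mono {a b a' b' : ℕ} (ha : a' ≤ a) (hb : b ≤ b') :
    posCone z a b ≤ posCone z a' b' := by
  refine AddSubmonoid.closure_mono ?_
  rintro x ⟨t, ht, S, hS, hab, rfl⟩
  exact ⟨t, ht, S, hS, fun s hs => ⟨ha.trans (hab s hs).1, (hab s hs).2.trans hb⟩, rfl⟩

theorem smul_mem_posCone {a b : ℕ} {t : ℝ} (ht : 0 ≤ t) {x : A} (hx : x ∈ posCone z a b) :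
    t • x ∈ posCone z a b := by
  induction hx using AddSubmonoid.closure_induction with
  | mem x hx =>
    obtain ⟨u, hu, S, hS, hab, rfl⟩ := hx
    rw [smul_smul]
    exact smul_prod_mem_posCone (mul_nonneg ht hu) hS hab
  | zero => simp
  | add x y _ _ hx hy => rw [smul_add]; exact add_mem hx hy

theorem one_mem_posCone (a b : ℕ) : (1 : A) ∈ posCone z a b := by
  simpa using prod_mem_posCone (z := z) (a := a) (b := b) (S := []) (by simp) (by simp)

theorem apply_mem_posCone {a b s : ℕ} (h : a ≤ s) (h' : s ≤ b) : z s ∈ posCone z a b := by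
  simpa using prod_mem_posCone (z := z) (a := a) (b := b) (S := [s]) (by simp) (by simp [h, h'])

theorem pair_mem_posCone {a b s : ℕ} (h : a ≤ s) (h' : s + 1 ≤ b) {p q : ℝ}
    (hp : 0 ≤ p) (hq : 0 ≤ q) : p • z s + q • z (s + 1) ∈ posCone z a b :=
  add_mem (smul_mem_posCone hp (apply_mem_posCone h (by omega)))
    (smul_mem_posCone hq (apply_mem_posCone (by omega) h'))

/-- The elements of `posCone z a b` in which some increasing product of `r` factors, with
indices in `Q`, occurs with a positive coefficient. -/
def StrictIn (z : ℕ → A) (a b : ℕ) (Q : Set ℕ) (r : ℕ) (x : A) : Prop :=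
  ∃ t : ℝ, 0 < t ∧ ∃ S : List ℕ, S.Pairwise (· < ·) ∧ (∀ s ∈ S, a ≤ s ∧ s ≤ b) ∧
    (∀ s ∈ S, s ∈ Q) ∧ S.length = r ∧ ∃ y ∈ posCone z a b, x = t • (S.map z).prod + y

theorem StrictIn.mem_posCone {a b r : ℕ} {Q : Set ℕ} {x : A} (h : StrictIn z a b Q r x) :
    x ∈ posCone z a b := by
  obtain ⟨t, ht, S, hS, hab, -, -, y, hy, rfl⟩ := h
  exact add_mem (smul_prod_mem_posCone ht.le hS hab) hy

theorem StrictIn.mono {a b a' b' r : ℕ} {Q Q' : Set ℕ} {x : A} (h : StrictIn z a b Q r x)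
    (ha : a' ≤ a) (hb : b ≤ b') (hQ : ∀ s, s ∈ Q → s ∈ Q') : StrictIn z a' b' Q' r x := by
  obtain ⟨t, ht, S, hS, hab, hSQ, hr, y, hy, rfl⟩ := h
  exact ⟨t, ht, S, hS, fun s hs => ⟨ha.trans (hab s hs).1, (hab s hs).2.trans hb⟩,
    fun s hs => hQ s (hSQ s hs), hr, y, posCone_mono ha hb hy, rfl⟩

theorem StrictIn.add {a b r : ℕ} {Q : Set ℕ} {x x' : A} (h : StrictIn z a b Q r x)
    (hx' : x' ∈ posCone z a b) : StrictIn z a b Q r (x + x') := by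
  obtain ⟨t, ht, S, hS, hab, hSQ, hr, y, hy, rfl⟩ := h
  exact ⟨t, ht, S, hS, hab, hSQ, hr, y + x', add_mem hy hx', add_assoc _ _ _⟩

theorem StrictIn.add_left {a b r : ℕ} {Q : Set ℕ} {x x' : A} (h : StrictIn z a b Q r x)
    (hx' : x' ∈ posCone z a b) : StrictIn z a b Q r (x' + x) :=
  add_comm x x' ▸ h.add hx'

theorem StrictIn.smul {a b r : ℕ} {Q : Set ℕ} {x : A} (h : StrictIn z a b Q r x)
    {u : ℝ} (hu : 0 < u) : StrictIn z a b Q r (u • x) := by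
  obtain ⟨t, ht, S, hS, hab, hSQ, hr, y, hy, rfl⟩ := h
  exact ⟨u * t, mul_pos hu ht, S, hS, hab, hSQ, hr, u • y, smul_mem_posCone hu.le hy, by
    rw [smul_add, smul_smul]⟩

theorem strictIn_prod {a b r : ℕ} {Q : Set ℕ} {S : List ℕ} (hS : S.Pairwise (· < ·))
    (hab : ∀ s ∈ S, a ≤ s ∧ s ≤ b) (hQ : ∀ s ∈ S, s ∈ Q) (hr : S.length = r) :
    StrictIn z a b Q r (S.map z).prod :=
  ⟨1, one_pos, S, hS, hab, hQ, hr, 0, zero_mem _, by simp⟩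

theorem strictIn_pair {a b s u : ℕ} {Q : Set ℕ} (h : a ≤ s) (h' : s + 1 ≤ b) {p q : ℝ}
    (hp : 0 < p) (hq : 0 < q) (hu : u = s ∨ u = s + 1) (hQ : u ∈ Q) :
    StrictIn z a b Q 1 (p • z s + q • z (s + 1)) := by
  have key : ∀ v, a ≤ v → v ≤ b → v ∈ Q → StrictIn z a b Q 1 (z v) := fun v h1 h2 h3 => by
    simpa using strictIn_prod (z := z) (S := [v]) (a := a) (b := b) (Q := Q) (r := 1)
      (by simp) (by simp [h1, h2]) (by simpa using h3) rfl
  rcases hu with rfl | rfl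
  · exact ((key u h (by omega) hQ).smul hp).add
      (smul_mem_posCone hq.le (apply_mem_posCone (by omega) h'))
  · exact ((key (s + 1) (by omega) h' hQ).smul hq).add_left
      (smul_mem_posCone hp.le (apply_mem_posCone h (by omega)))

variable (hz : ∀ a b, z a * z b = -(z b * z a))
include hz

theorem apply_mul_self_eq_zero (a : ℕ) : z a * z a = 0 := by
  have h : (2 : ℝ) • (z a * z a) = 0 := by
    rw [two_smul]
    exact add_eq_zero_iff_eq_neg.2 (hz a a)
  exact (smul_eq_zero.1 h).resolve_left two_ne_zero

theorem mul_mem_posCone {a b c : ℕ} (hac : a ≤ c) (hcb : c ≤ b) {x y : A}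
    (hx : x ∈ posCone z a c) (hy : y ∈ posCone z c b) : x * y ∈ posCone z a b := by
  induction hx using AddSubmonoid.closure_induction with
  | zero => simp
  | add x x' _ _ hx hx' => rw [add_mul]; exact add_mem hx hx'
  | mem x hx =>
    obtain ⟨t, ht, S, hS, hab, rfl⟩ := hx
    induction hy using AddSubmonoid.closure_induction with
    | zero => simp
    | add y y' _ _ hy hy' => rw [mul_add]; exact add_mem hy hy'
    | mem y hy =>
      obtain ⟨u, hu, T, hT, hcd, rfl⟩ := hy
      rw [smul_mul_smul_comm]
      refine smul_mem_posCone (mul_nonneg ht hu) ?_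
      by_cases hc : c ∈ S ∧ c ∈ T
      · obtain ⟨hcS, hcT⟩ := hc
        obtain ⟨S₁, S₂, rfl⟩ := List.append_of_mem hcS
        obtain ⟨T₁, T₂, rfl⟩ := List.append_of_mem hcT
        have hS₂ : S₂ = [] := List.eq_nil_iff_forall_not_mem.2 fun s hs => by
          have h1 := (hab s (by simp [hs])).2
          have h2 := (List.pairwise_cons.1 (List.pairwise_append.1 hS).2.1).1 s hs
          omega
        have hT₁ : T₁ = [] := List.eq_nil_iff_forall_not_mem.2 fun s hs => by
          have h1 := (hcd s (by simp [hs])).1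
          have h2 := (List.pairwise_append.1 hT).2.2 s hs c (by simp)
          omega
        subst hS₂ hT₁
        have h0 := apply_mul_self_eq_zero hz c
        have : ((S₁ ++ [c]).map z).prod * (([] ++ c :: T₂).map z).prod
            = (S₁.map z).prod * (z c * z c) * (T₂.map z).prod := by
          simp [mul_assoc]
        rw [this, h0]
        simp
      · rw [← List.prod_append, ← List.map_append]
        refine prod_mem_posCone (List.pairwise_append.2 ⟨hS, hT, fun s hs s' hs' => ?_⟩) ?_
        · have h1 := (hab s hs).2
          have h2 := (hcd s' hs').1
          refine lt_of_le_of_ne (h1.trans h2) ?_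
          rintro rfl
          obtain rfl : s = c := by omega
          exact hc ⟨hs, hs'⟩
        · intro s hs
          rcases List.mem_append.1 hs with h | h
          · have := hab s h; omega
          · have := hcd s h; omega

theorem StrictIn.mul {a b c r r' m : ℕ} {Q Q' R : Set ℕ} {x y : A}
    (hx : StrictIn z a c Q r x) (hy : StrictIn z c b Q' r' y) (hac : a ≤ c) (hcb : c ≤ b)
    (hlt : ∀ s ∈ Q, ∀ s' ∈ Q', s < s') (hQ : ∀ s ∈ Q, s ∈ R) (hQ' : ∀ s ∈ Q', s ∈ R)
    (hm : r + r' = m) : StrictIn z a b R m (x * y) := by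
  have hym := hy.mem_posCone
  obtain ⟨t, ht, S, hS, hab, hSQ, rfl, x', hx', rfl⟩ := hx
  obtain ⟨u, hu, T, hT, hcd, hTQ, rfl, y', hy', rfl⟩ := hy
  refine ⟨t * u, mul_pos ht hu, S ++ T,
    List.pairwise_append.2 ⟨hS, hT, fun s hs s' hs' => hlt s (hSQ s hs) s' (hTQ s' hs')⟩,
    ?_, ?_, by simpa using hm, t • (S.map z).prod * y' + x' * (u • (T.map z).prod + y'),
    add_mem (mul_mem_posCone hz hac hcb (smul_prod_mem_posCone ht.le hS hab) hy')
      (mul_mem_posCone hz hac hcb hx' hym), ?_⟩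
  · intro s hs
    rcases List.mem_append.1 hs with h | h
    · have := hab s h; omega
    · have := hcd s h; omega
  · intro s hs
    rcases List.mem_append.1 hs with h | h
    · exact hQ s (hSQ s h)
    · exact hQ' s (hTQ s h)
  · rw [List.map_append, List.prod_append, add_mul, mul_add, smul_mul_smul_comm, add_assoc]

theorem prod_mul_apply_eq_zero {S : List ℕ} {j : ℕ} (hj : j ∈ S) :
    (S.map z).prod * z j = 0 := by
  obtain ⟨S₁, S₂, rfl⟩ := List.append_of_mem hj
  have key : ∀ T : List ℕ, z j * (T.map z).prod * z j = 0 := fun T => by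
    induction T with
    | nil => simpa using apply_mul_self_eq_zero hz j
    | cons s T ih =>
      rw [List.map_cons, List.prod_cons, ← mul_assoc, hz j s, neg_mul, neg_mul, mul_assoc (z s),
        mul_assoc (z s), ih, mul_zero, neg_zero]
  rw [List.map_append, List.prod_append, List.map_cons, List.prod_cons, mul_assoc, key, mul_zero]

theorem mul_pair_mem_posCone {a b j : ℕ} (ha : a ≤ j) (hb : j + 1 ≤ b) {x : A}
    (hx : x ∈ posCone z a b) : x * (z j * z (j + 1)) ∈ posCone z a b := by
  induction hx using AddSubmonoid.closure_induction with
  | zero => simp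
  | add x y _ _ hx hy => rw [add_mul]; exact add_mem hx hy
  | mem x hx =>
    obtain ⟨t, ht, S, hS, hab, rfl⟩ := hx
    rw [smul_mul_assoc]
    refine smul_mem_posCone ht ?_
    by_cases hj : j ∈ S
    · rw [← mul_assoc, prod_mul_apply_eq_zero hz hj, zero_mul]
      exact zero_mem _
    by_cases hj' : j + 1 ∈ S
    · rw [hz j, mul_neg, ← mul_assoc, prod_mul_apply_eq_zero hz hj', zero_mul, neg_zero]
      exact zero_mem _
    obtain ⟨T, hT, hmem, -, hprod⟩ := prod_mul_pair hz hS hj hj'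
    rw [hprod]
    refine prod_mem_posCone hT fun s hs => ?_
    rcases (hmem s).1 hs with hs | rfl | rfl
    · exact hab s hs
    · omega
    · omega

theorem StrictIn.mul_pair {a b j r : ℕ} {Q Q' : Set ℕ} (ha : a ≤ j) (hb : j + 1 ≤ b) {x : A}
    (hx : StrictIn z a b Q r x) (hj : j ∉ Q) (hj' : j + 1 ∉ Q) (hQ : ∀ s ∈ Q, s ∈ Q')
    (hQj : j ∈ Q') (hQj' : j + 1 ∈ Q') :
    StrictIn z a b Q' (r + 2) (x * (z j * z (j + 1))) := by
  obtain ⟨t, ht, S, hS, hab, hSQ, rfl, y, hy, rfl⟩ := hx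
  obtain ⟨T, hT, hmem, hlen, hprod⟩ := prod_mul_pair hz hS (fun h => hj (hSQ _ h))
    (fun h => hj' (hSQ _ h))
  refine ⟨t, ht, T, hT, fun s hs => ?_, fun s hs => ?_, hlen, y * (z j * z (j + 1)),
    mul_pair_mem_posCone hz ha hb hy, by rw [add_mul, smul_mul_assoc, hprod]⟩
  · rcases (hmem s).1 hs with hs | rfl | rfl
    · exact hab s hs
    · omega
    · omega
  · rcases (hmem s).1 hs with hs | rfl | rfl
    · exact hQ s (hSQ s hs)
    · exact hQj
    · exact hQj'

end PosCone

/-! ### Domino forms of chord forests -/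

/-- A chord together with its domino variables. -/
structure DominoChord where
  tail : ℕ
  head : ℕ
  α : ℝ
  β : ℝ
  γ : ℝ
  δ : ℝ
  ε : ℝ

/-- The labels of a binary tree, from left to right. -/
def BinaryTree.inorder {I : Type*} : BinaryTree I → List I
  | .nil => []
  | .node l L R => L.inorder ++ l :: R.inorder

theorem BinaryTree.length_inorder {I : Type*} (T : BinaryTree I) :
    T.inorder.length = T.numNodes := by
  induction T with
  | nil => rfl
  | node l L R hL hR => simp [inorder, hL, hR]; omega

namespace DominoChord

section Identity

variable {I A : Type*} [Ring A] [Algebra ℝ A]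

/-- The tail part of the row of a chord. -/
def tailVec (z : ℕ → A) (c : DominoChord) : A := c.α • z c.tail + c.β • z (c.tail + 1)

/-- The head part of the row of a chord. -/
def headVec (z : ℕ → A) (c : DominoChord) : A := c.γ • z c.head + c.δ • z (c.head + 1)

/-- A binary tree encodes a forest of chords: the root is the last top chord, the left subtree
encodes the chords before it and the right subtree its descendants. `rowsProd z c u T` is the
product of the domino rows, where `u` is the vector inherited by the top chords. -/
def rowsProd (z : ℕ → A) (c : I → DominoChord) : A → BinaryTree I → A
  | _, .nil => 1
  | u, .node l L R => rowsProd z c u L *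
      (tailVec z (c l) + headVec z (c l) + (c l).ε • u) * rowsProd z c (tailVec z (c l)) R

/-- The two components `(F, G)` of `rowsProd z c u T = F + u * G`. -/
def forms (z : ℕ → A) (c : I → DominoChord) : BinaryTree I → A × A
  | .nil => (1, 0)
  | .node l L R =>
    let v := tailVec z (c l)
    let w := (-1 : ℝ) ^ R.numNodes • headVec z (c l)
    let x := v * (forms z c R).1 + (forms z c R).1 * w + v * ((forms z c R).2 * w)
    ((forms z c L).1 * x, (forms z c L).2 * x +
      ((-1 : ℝ) ^ L.numNodes * (c l).ε) •
        ((forms z c L).1 * ((forms z c R).1 + v * (forms z c R).2)))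

variable {z : ℕ → A} {c : I → DominoChord}

theorem anticomm_of_span {u : A} {a b : ℕ} {p q : ℝ} (h : ∀ s, u * z s = -(z s * u)) :
    u * (p • z a + q • z b) = -((p • z a + q • z b) * u) := by
  simp only [mul_add, add_mul, mul_smul_comm, smul_mul_assoc, h, smul_neg]
  abel

theorem anticomm_headVec {u : A} (h : ∀ s, u * z s = -(z s * u)) (d : DominoChord) :
    u * headVec z d = -(headVec z d * u) := anticomm_of_span h

theorem anticomm_tailVec {u : A} (h : ∀ s, u * z s = -(z s * u)) (d : DominoChord) :
    u * tailVec z d = -(tailVec z d * u) := anticomm_of_span h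

theorem mul_forms {u : A} (h : ∀ s, u * z s = -(z s * u)) (T : BinaryTree I) :
    u * (forms z c T).1 = (-1 : ℝ) ^ T.numNodes • ((forms z c T).1 * u) ∧
    u * (forms z c T).2 = -((-1 : ℝ) ^ T.numNodes • ((forms z c T).2 * u)) := by
  induction T with
  | nil => simp [forms]
  | node l L R hL hR =>
    have hv := anticomm_tailVec h (c l)
    have hw := anticomm_headVec h (c l)
    simp only [forms, BinaryTree.numNodes]
    generalize tailVec z (c l) = v at *
    generalize headVec z (c l) = w at *
    generalize (forms z c L).1 = F at *
    generalize (forms z c L).2 = G at *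
    generalize (forms z c R).1 = F' at *
    generalize (forms z c R).2 = G' at *
    have key : u * (v * F' + F' * ((-1 : ℝ) ^ R.numNodes • w)
        + v * (G' * ((-1 : ℝ) ^ R.numNodes • w)))
        = (-1 : ℝ) ^ (R.numNodes + 1) • ((v * F' + F' * ((-1 : ℝ) ^ R.numNodes • w)
        + v * (G' * ((-1 : ℝ) ^ R.numNodes • w))) * u) := by
      have h1 : u * (v * F') = (-1 : ℝ) ^ (R.numNodes + 1) • (v * F' * u) := by
        rw [← mul_assoc, hv, neg_mul, mul_assoc, hR.1, pow_succ]
        simp [mul_assoc]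
      have h2 : u * (F' * w) = (-1 : ℝ) ^ (R.numNodes + 1) • (F' * w * u) := by
        rw [← mul_assoc, hR.1, smul_mul_assoc, mul_assoc, hw, pow_succ]
        simp [mul_assoc]
      have h3 : u * (v * (G' * w)) = (-1 : ℝ) ^ (R.numNodes + 1) • (v * (G' * w) * u) := by
        rw [← mul_assoc, hv, neg_mul, mul_assoc, ← mul_assoc u, hR.2, neg_mul, smul_mul_assoc,
          mul_assoc G', hw, pow_succ]
        simp [mul_assoc]
      simp only [mul_add, add_mul, mul_smul_comm, smul_mul_assoc, smul_add, h1, h2, h3]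
      simp only [smul_smul, mul_comm]
    generalize v * F' + F' * ((-1 : ℝ) ^ R.numNodes • w)
        + v * (G' * ((-1 : ℝ) ^ R.numNodes • w)) = x at *
    have h4 : u * (F * F') = (-1 : ℝ) ^ (L.numNodes + R.numNodes) • (F * F' * u) := by
      rw [← mul_assoc, hL.1, smul_mul_assoc, mul_assoc, hR.1, pow_add]
      simp [mul_assoc, smul_smul]
    have h5 : u * (F * (v * G')) = (-1 : ℝ) ^ (L.numNodes + R.numNodes) • (F * (v * G') * u) := by
      rw [← mul_assoc, hL.1, smul_mul_assoc, mul_assoc, ← mul_assoc u, hv, neg_mul, mul_assoc v,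
        hR.2, pow_add]
      simp [mul_assoc, smul_smul]
    refine ⟨?_, ?_⟩
    · rw [← mul_assoc, hL.1, smul_mul_assoc, mul_assoc, key, mul_smul_comm, smul_smul, ← pow_add,
        mul_assoc, add_assoc]
    · rw [mul_add, ← mul_assoc, hL.2, neg_mul, smul_mul_assoc, mul_assoc, key, mul_smul_comm,
        mul_add F, mul_smul_comm, mul_add, h4, h5, add_mul, smul_mul_assoc, add_mul, mul_assoc G]
      module

variable (hz : ∀ a b, z a * z b = -(z b * z a))
include hz

theorem tailVec_anticomm (d : DominoChord) (s : ℕ) :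
    tailVec z d * z s = -(z s * tailVec z d) := by
  rw [anticomm_tailVec (fun t => hz s t), neg_neg]

theorem tailVec_mul_self (d : DominoChord) : tailVec z d * tailVec z d = 0 := by
  have h1 := apply_mul_self_eq_zero hz
  simp [tailVec, mul_add, add_mul, h1, hz (d.tail + 1) d.tail, smul_smul, mul_comm]

theorem headVec_anticomm (d : DominoChord) (s : ℕ) :
    headVec z d * z s = -(z s * headVec z d) := by
  rw [anticomm_headVec (fun t => hz s t), neg_neg]

theorem rowsProd_eq (T : BinaryTree I) {u : A} (h : ∀ s, u * z s = -(z s * u)) (hu : u * u = 0) :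
    rowsProd z c u T = (forms z c T).1 + u * (forms z c T).2 := by
  induction T generalizing u with
  | nil => simp [rowsProd, forms]
  | node l L R hL hR =>
    rw [rowsProd, hL h hu, hR (tailVec_anticomm hz _) (tailVec_mul_self hz _)]
    have h1 := (mul_forms (c := c) h L).1
    have h2 := (mul_forms (c := c) (headVec_anticomm hz (c l)) R)
    have h3 := tailVec_mul_self hz (c l)
    have h4 := (mul_forms (c := c) h L).2
    have h5 := anticomm_headVec (tailVec_anticomm hz (c l)) (c l)
    simp only [forms]
    generalize tailVec z (c l) = v at *
    generalize headVec z (c l) = w at *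
    generalize (forms z c L).1 = F at *
    generalize (forms z c L).2 = G at *
    generalize (forms z c R).1 = F' at *
    generalize (forms z c R).2 = G' at *
    have h6 : ∀ r : ℝ, F * (r • u) = ((-1) ^ L.numNodes * r) • (u * F) := fun r => by
      rw [h1, smul_smul, mul_comm, ← mul_assoc, ← mul_pow]
      simp
    have h7 : u * G * u = 0 := by
      rw [h4, neg_mul, smul_mul_assoc, mul_assoc, hu]
      simp
    have h8 : (v + w) * (F' + v * G') = v * F' + F' * ((-1 : ℝ) ^ R.numNodes • w)
        + v * (G' * ((-1 : ℝ) ^ R.numNodes • w)) := by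
      have : w * (v * G') = v * (G' * ((-1 : ℝ) ^ R.numNodes • w)) := by
        rw [← mul_assoc, ← neg_eq_iff_eq_neg.2 h5, neg_mul, mul_assoc, h2.2]
        simp
      rw [add_mul, mul_add, mul_add, ← mul_assoc v v, h3, zero_mul, add_zero, h2.1, this,
        ← mul_smul_comm, add_assoc]
    rw [← h8]
    generalize F' + v * G' = y
    have h9 : (F + u * G) * (v + w + (c l).ε • u) * y = F * ((v + w) * y)
        + F * ((c l).ε • u) * y + u * (G * ((v + w) * y)) + (c l).ε • (u * G * u * y) := by
      simp only [add_mul, mul_add, mul_assoc, smul_mul_assoc, mul_smul_comm, smul_add]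
      abel
    rw [h9, h6, h7, zero_mul, smul_zero, add_zero, add_assoc, mul_add u]
    simp only [mul_assoc, smul_mul_assoc, mul_smul_comm]
    abel

end Identity

section Positivity

variable {I A : Type*} [Ring A] [Algebra ℝ A] {z : ℕ → A} {c : I → DominoChord}

/-- The sign condition on the variables `ε` of the top chords of a forest. -/
def EpsPos (c : I → DominoChord) : BinaryTree I → Prop
  | .nil => True
  | .node l L _ => 0 < (-1 : ℝ) ^ L.numNodes * (c l).ε ∧ EpsPos c L

/-- The forest encoded by the tree has its tails at or after `a` and its heads at or before `h`,
and its domino variables satisfy the sign rules, except those on `ε` for its top chords. -/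
def Admissible (c : I → DominoChord) : BinaryTree I → ℕ → ℕ → Prop
  | .nil, a, h => a ≤ h
  | .node l L R, a, h => (a ≤ (c l).tail ∧ (c l).tail + 2 ≤ (c l).head ∧ (c l).head ≤ h) ∧
      (0 < (c l).α ∧ 0 < (c l).β ∧ 0 < (-1 : ℝ) ^ R.numNodes * (c l).γ ∧
        0 < (-1 : ℝ) ^ R.numNodes * (c l).δ) ∧
      (∀ m ∈ L.inorder, (c m).head = (c l).tail → (c m).δ / (c m).γ < (c l).β / (c l).α) ∧
      (∀ m ∈ R.inorder, (c m).head = (c l).head → (c m).δ / (c m).γ < (c l).δ / (c l).γ) ∧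
      Admissible c L a (c l).tail ∧ Admissible c R ((c l).tail + 1) (c l).head ∧ EpsPos c R

theorem signed_headVec (d : DominoChord) (r : ℕ) :
    (-1 : ℝ) ^ r • headVec z d
      = ((-1 : ℝ) ^ r * d.γ) • z d.head + ((-1 : ℝ) ^ r * d.δ) • z (d.head + 1) := by
  rw [headVec, smul_add, smul_smul, smul_smul]

theorem signed_ratio (r : ℕ) (x y : ℝ) : ((-1 : ℝ) ^ r * x) / ((-1 : ℝ) ^ r * y) = x / y :=
  mul_div_mul_left _ _ (pow_ne_zero _ (by norm_num))

variable (hz : ∀ a b, z a * z b = -(z b * z a))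
include hz

theorem pair_mul_pair (p q p' q' : ℝ) (h : ℕ) :
    (p • z h + q • z (h + 1)) * (p' • z h + q' • z (h + 1))
      = (p * q' - q * p') • (z h * z (h + 1)) := by
  have h1 := apply_mul_self_eq_zero hz
  simp only [mul_add, add_mul, smul_mul_smul_comm, h1, hz (h + 1) h]
  module

/-- `forms z c T` has nonnegative components, also after multiplication by a positive vector on
`h, h + 1` whose slope exceeds the slopes of all the heads at `h`. -/
theorem forms_mem_posCone {T : BinaryTree I} {a h : ℕ} (hT : Admissible c T a h) :
    ((forms z c T).1 ∈ posCone z a (h + 1) ∧ ∀ p q : ℝ, 0 < p → 0 < q →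
      (∀ m ∈ T.inorder, (c m).head = h → (c m).δ / (c m).γ < q / p) →
      (forms z c T).1 * (p • z h + q • z (h + 1)) ∈ posCone z a (h + 1)) ∧
    (EpsPos c T → (forms z c T).2 ∈ posCone z a (h + 1) ∧ ∀ p q : ℝ, 0 < p → 0 < q →
      (∀ m ∈ T.inorder, (c m).head = h → (c m).δ / (c m).γ < q / p) →
      (forms z c T).2 * (p • z h + q • z (h + 1)) ∈ posCone z a (h + 1)) := by
  induction T generalizing a h with
  | nil =>
    refine ⟨⟨one_mem_posCone _ _, fun p q hp hq _ => ?_⟩, fun _ =>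
      ⟨zero_mem _, fun p q hp hq _ => by simp [forms]⟩⟩
    simpa [forms] using pair_mem_posCone hT le_rfl hp.le hq.le
  | node l L R hL hR =>
    obtain ⟨⟨ha, hth, hh⟩, ⟨hα, hβ, hγ, hδ⟩, hsL, hsR, hAL, hAR, hεR⟩ := hT
    obtain ⟨⟨hF, hFv⟩, hG⟩ := hL hAL
    obtain ⟨⟨hF', hFw'⟩, hG'⟩ := hR hAR
    obtain ⟨hG', hGw'⟩ := hG' hεR
    replace hFv := hFv _ _ hα hβ hsL
    have hslope : ∀ m ∈ R.inorder, (c m).head = (c l).head → (c m).δ / (c m).γ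
        < ((-1 : ℝ) ^ R.numNodes * (c l).δ) / ((-1 : ℝ) ^ R.numNodes * (c l).γ) := by
      simpa only [signed_ratio] using hsR
    have hFw := hFw' _ _ hγ hδ hslope
    have hGw := hGw' _ _ hγ hδ hslope
    -- the last factor extended by a vector `y` with the stated property
    have hx : ∀ x : A, x ∈ posCone z a ((c l).tail + 1) →
        x * tailVec z (c l) ∈ posCone z a ((c l).tail + 1) →
        x * (tailVec z (c l) * (forms z c R).1
          + (forms z c R).1 * ((-1 : ℝ) ^ R.numNodes • headVec z (c l))
          + tailVec z (c l) * ((forms z c R).2 * ((-1 : ℝ) ^ R.numNodes • headVec z (c l))))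
          ∈ posCone z a ((c l).head + 1) ∧
        ∀ p q : ℝ, 0 < p → 0 < q →
          (∀ m ∈ (BinaryTree.node l L R).inorder, (c m).head = h → (c m).δ / (c m).γ < q / p) →
          x * (tailVec z (c l) * (forms z c R).1
          + (forms z c R).1 * ((-1 : ℝ) ^ R.numNodes • headVec z (c l))
          + tailVec z (c l) * ((forms z c R).2 * ((-1 : ℝ) ^ R.numNodes • headVec z (c l))))
          * (p • z h + q • z (h + 1)) ∈ posCone z a (h + 1) := by
      intro x hx hxv
      have h0 : x * (tailVec z (c l) * (forms z c R).1
          + (forms z c R).1 * ((-1 : ℝ) ^ R.numNodes • headVec z (c l))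
          + tailVec z (c l) * ((forms z c R).2 * ((-1 : ℝ) ^ R.numNodes • headVec z (c l))))
          ∈ posCone z a ((c l).head + 1) := by
        rw [signed_headVec, mul_add, mul_add, ← mul_assoc, ← mul_assoc x (tailVec z (c l))]
        exact add_mem (add_mem (mul_mem_posCone hz (by omega) (by omega) hxv hF')
          (mul_mem_posCone hz (by omega) (by omega) hx hFw))
          (mul_mem_posCone hz (by omega) (by omega) hxv hGw)
      refine ⟨h0, fun p q hp hq hpq => ?_⟩
      rcases hh.lt_or_eq with hlt | rfl
      · exact mul_mem_posCone hz (c := h) (by omega) (by omega) (posCone_mono le_rfl hlt h0)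
          (pair_mem_posCone le_rfl le_rfl hp.le hq.le)
      · have hl := hpq l (by simp [BinaryTree.inorder]) rfl
        have hpq' : 0 ≤ (-1 : ℝ) ^ R.numNodes * (c l).γ * q -
            (-1 : ℝ) ^ R.numNodes * (c l).δ * p := by
          rw [← signed_ratio R.numNodes, div_lt_div_iff₀ hγ hp] at hl
          linarith
        have hRw := hFw' p q hp hq fun m hm => hpq m (by simp [BinaryTree.inorder, hm])
        rw [signed_headVec, mul_assoc, add_mul, add_mul, mul_assoc _ (_ + _) (_ + _),
          mul_assoc _ ((forms z c R).2 * _), mul_assoc (forms z c R).2, pair_mul_pair hz,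
          mul_smul_comm, mul_smul_comm, mul_smul_comm, mul_add, mul_add, mul_smul_comm,
          mul_smul_comm, mul_assoc, ← mul_assoc x (tailVec z (c l)),
          ← mul_assoc x (tailVec z (c l))]
        exact add_mem (add_mem (mul_mem_posCone hz (by omega) (by omega) hxv hRw)
          (smul_mem_posCone hpq' (mul_mem_posCone hz (by omega) (by omega) hx
            (mul_pair_mem_posCone hz (by omega) le_rfl hF'))))
          (smul_mem_posCone hpq' (mul_mem_posCone hz (by omega) (by omega) hxv
            (mul_pair_mem_posCone hz (by omega) le_rfl hG')))
    have h1 := hx _ hF hFv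
    refine ⟨⟨posCone_mono le_rfl (by omega) h1.1, h1.2⟩, fun hε => ?_⟩
    obtain ⟨hG, hGv⟩ := hG hε.2
    replace hGv := hGv _ _ hα hβ hsL
    have h2 := hx _ hG hGv
    have h3 : (forms z c L).1 * ((forms z c R).1 + tailVec z (c l) * (forms z c R).2)
        ∈ posCone z a ((c l).head + 1) := by
      rw [mul_add, ← mul_assoc]
      exact add_mem (mul_mem_posCone hz (by omega) (by omega) hF hF')
        (mul_mem_posCone hz (by omega) (by omega) hFv hG')
    refine ⟨posCone_mono le_rfl (by omega) (add_mem h2.1 (smul_mem_posCone hε.1.le h3)),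
      fun p q hp hq hpq => ?_⟩
    rw [forms]
    dsimp only
    rw [add_mul, smul_mul_assoc]
    refine add_mem (h2.2 p q hp hq hpq) (smul_mem_posCone hε.1.le ?_)
    rcases hh.lt_or_eq with hlt | rfl
    · exact mul_mem_posCone hz (c := h) (by omega) (by omega) (posCone_mono le_rfl hlt h3)
        (pair_mem_posCone le_rfl le_rfl hp.le hq.le)
    · have hpq' : ∀ m ∈ R.inorder, (c m).head = (c l).head → (c m).δ / (c m).γ < q / p :=
        fun m hm => hpq m (by simp [BinaryTree.inorder, hm])
      rw [mul_assoc, add_mul, mul_add, mul_assoc (tailVec z (c l)), ← mul_assoc _ (tailVec z (c l))]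
      exact add_mem (mul_mem_posCone hz (by omega) (by omega) hF (hFw' p q hp hq hpq'))
        (mul_mem_posCone hz (by omega) (by omega) hFv (hGw' p q hp hq hpq'))

/-- The first component of `forms z c T` contains an increasing product avoiding `j, j + 1`. -/
theorem strictIn_forms {T : BinaryTree I} {a h : ℕ} (hT : Admissible c T a h) (j : ℕ) :
    StrictIn z a (h + 1) {s | a ≤ s ∧ (j < a → a < s) ∧ s ≤ h + 1 ∧ (j < a ∨ h ≤ j + 1 → s < h) ∧
      s ≠ j ∧ s ≠ j + 1} T.numNodes (forms z c T).1 ∧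
    ∀ p q : ℝ, 0 < p → 0 < q → j ≠ h →
      (∀ m ∈ T.inorder, (c m).head = h → (c m).δ / (c m).γ < q / p) →
      StrictIn z a (h + 1) {s | a ≤ s ∧ (j < a → a < s) ∧ s ≤ h + 1 ∧ (h < j → s ≤ h) ∧
        s ≠ j ∧ s ≠ j + 1} (T.numNodes + 1) ((forms z c T).1 * (p • z h + q • z (h + 1))) := by
  induction T generalizing a h with
  | nil =>
    refine ⟨by simpa [forms] using
      strictIn_prod (z := z) (S := []) (by simp) (by simp) (by simp) rfl,
      fun p q hp hq hj _ => ?_⟩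
    have ha : a ≤ h := hT
    rw [forms, one_mul]
    rcases hj.lt_or_gt with hj | hj
    · exact strictIn_pair (u := h + 1) ha le_rfl hp hq (by simp) (by simp; omega)
    · exact strictIn_pair (u := h) ha le_rfl hp hq (by simp) (by simp; omega)
  | node l L R hL hR =>
    obtain ⟨⟨ha, hth, hh⟩, ⟨hα, hβ, hγ, hδ⟩, hsL, hsR, hAL, hAR, hεR⟩ := hT
    obtain ⟨⟨hF, hFv⟩, -⟩ := forms_mem_posCone hz hAL
    obtain ⟨⟨hF', hFw'⟩, hG'⟩ := forms_mem_posCone hz hAR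
    obtain ⟨hG', hGw'⟩ := hG' hεR
    replace hFv := hFv _ _ hα hβ hsL
    have hslope : ∀ m ∈ R.inorder, (c m).head = (c l).head → (c m).δ / (c m).γ
        < ((-1 : ℝ) ^ R.numNodes * (c l).δ) / ((-1 : ℝ) ^ R.numNodes * (c l).γ) := by
      simpa only [signed_ratio] using hsR
    have hFw := hFw' _ _ hγ hδ hslope
    have hGw := hGw' _ _ hγ hδ hslope
    obtain ⟨hLs, hLv⟩ := hL hAL
    obtain ⟨hRs, hRw'⟩ := hR hAR
    replace hLv := fun hj => hLv _ _ hα hβ hj hsL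
    have hRw := fun hj => hRw' _ _ hγ hδ hj hslope
    have hvF := mul_mem_posCone hz (by omega) (by omega) hFv hF'
    have hFw := mul_mem_posCone hz (by omega) (by omega) hF hFw
    have hvGw := mul_mem_posCone hz (by omega) (by omega) hFv hGw
    have h0 : StrictIn z a ((c l).head + 1) {s | a ≤ s ∧ (j < a → a < s) ∧ s ≤ (c l).head + 1 ∧
        (j < a ∨ (c l).head ≤ j + 1 → s < (c l).head) ∧ s ≠ j ∧ s ≠ j + 1}
        (BinaryTree.node l L R).numNodes (forms z c (.node l L R)).1 := by
      simp only [forms]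
      rw [signed_headVec, mul_add, mul_add, ← mul_assoc, ← mul_assoc _ (tailVec z (c l))]
      by_cases hj : j = (c l).tail
      · refine StrictIn.add (StrictIn.add_left ?_ hvF) hvGw
        exact StrictIn.mul hz hLs (hRw (by omega)) (by omega) (by omega)
          (by simp; omega) (by simp; omega) (by simp; omega) (by simp; omega)
      · refine StrictIn.add (StrictIn.add ?_ hFw) hvGw
        exact StrictIn.mul hz (hLv hj) hRs (by omega) (by omega)
          (by simp; omega) (by simp; omega) (by simp; omega) (by simp; omega)
    refine ⟨h0.mono le_rfl (by omega) (by simp; omega), fun p q hp hq hj hpq => ?_⟩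
    rcases hh.lt_or_eq with hlt | rfl
    · refine StrictIn.mul hz (c := h) (Q' := {if j < h then h + 1 else h})
        (h0.mono le_rfl (by omega) (fun _ => id))
        (strictIn_pair (u := if j < h then h + 1 else h) le_rfl le_rfl hp hq
          (by split_ifs <;> simp) rfl) (by omega) (by omega) ?_ ?_ ?_ rfl
      · simp; split_ifs <;> omega
      · simp; omega
      · simp; split_ifs <;> omega
    · have hl := hpq l (by simp [BinaryTree.inorder]) rfl
      have hpq' : 0 < (-1 : ℝ) ^ R.numNodes * (c l).γ * q -
          (-1 : ℝ) ^ R.numNodes * (c l).δ * p := by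
        rw [← signed_ratio R.numNodes, div_lt_div_iff₀ hγ hp] at hl
        linarith
      have hpqR : ∀ m ∈ R.inorder, (c m).head = (c l).head → (c m).δ / (c m).γ < q / p :=
        fun m hm => hpq m (by simp [BinaryTree.inorder, hm])
      have hvFw := mul_mem_posCone hz (by omega) (by omega) hFv (hFw' p q hp hq hpqR)
      have hFww := mul_mem_posCone hz (by omega) (by omega) hF
        (mul_pair_mem_posCone hz (j := (c l).head) (by omega) le_rfl hF')
      have hvGww := mul_mem_posCone hz (by omega) (by omega) hFv
        (mul_pair_mem_posCone hz (j := (c l).head) (by omega) le_rfl hG')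
      simp only [forms]
      rw [signed_headVec, mul_assoc, add_mul, add_mul, mul_assoc _ (_ + _) (_ + _),
        mul_assoc _ ((forms z c R).2 * _), mul_assoc (forms z c R).2, pair_mul_pair hz,
        mul_smul_comm, mul_smul_comm, mul_smul_comm, mul_add, mul_add, mul_smul_comm,
        mul_smul_comm, mul_assoc, ← mul_assoc _ (tailVec z (c l)), ← mul_assoc _ (tailVec z (c l))]
      by_cases hj' : j = (c l).tail
      · refine StrictIn.add (StrictIn.add_left (StrictIn.smul ?_ hpq') hvFw)
          (smul_mem_posCone hpq'.le hvGww)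
        refine StrictIn.mul hz hLs (StrictIn.mul_pair hz
          (Q' := {s | (c l).tail + 1 < s ∧ s ≤ (c l).head + 1}) (by omega) le_rfl hRs
          ?_ ?_ ?_ ?_ ?_) (by omega) (by omega) ?_ ?_ ?_ ?_ <;> simp <;> omega
      · refine StrictIn.add (StrictIn.add ?_ (smul_mem_posCone hpq'.le hFww))
          (smul_mem_posCone hpq'.le hvGww)
        exact StrictIn.mul hz (hLv hj') (hRw' p q hp hq hj hpqR) (by omega) (by omega)
          (by simp; omega) (by simp; omega) (by simp; omega) (by simp; omega)

end Positivity

section Quadratic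

variable {I A : Type*} [Ring A] [Algebra ℝ A] {z : ℕ → A} {c : I → DominoChord}
variable (hz : ∀ a b, z a * z b = -(z b * z a))
include hz

theorem rowsProd_mul (T : BinaryTree I) (m a₁ a₂ a₃ : ℕ) :
    rowsProd z c (z m) T * (z a₁ * (z a₂ * (z a₃ * z m)))
      = (forms z c T).1 * (z a₁ * (z a₂ * (z a₃ * z m))) := by
  rw [rowsProd_eq hz T (hz m) (apply_mul_self_eq_zero hz m), add_mul, (mul_forms (hz m) T).2]
  have h := prod_mul_apply_eq_zero hz (S := [m, a₁, a₂, a₃]) (j := m) (by simp)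
  simp only [List.map_cons, List.map_nil, List.prod_cons, List.prod_nil, mul_one, mul_assoc] at h
  rw [neg_mul, smul_mul_assoc, mul_assoc, h]
  simp

variable {l : I} {L R : BinaryTree I}

theorem forms_mul_of_repeat {s h m : ℕ} (hh : (c l).head = h) :
    (forms z c (.node l L R)).1 * (z s * (z h * (z (h + 1) * z m)))
      = (-1 : ℝ) ^ R.numNodes • ((forms z c L).1 * (forms z c R).1 *
        (tailVec z (c l) * z s * (z h * z (h + 1))) * z m) := by
  have hw : headVec z (c l) * (z s * (z h * (z (h + 1) * z m))) = 0 := by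
    have h1 := prod_mul_apply_eq_zero hz (S := [h, s]) (j := h) (by simp)
    have h2 := prod_mul_apply_eq_zero hz (S := [h + 1, s, h]) (j := h + 1) (by simp)
    simp only [List.map_cons, List.map_nil, List.prod_cons, List.prod_nil, mul_one] at h1 h2
    rw [headVec, hh, add_mul, smul_mul_assoc, smul_mul_assoc]
    have e1 : z h * (z s * (z h * (z (h + 1) * z m))) = z h * z s * z h * (z (h + 1) * z m) := by
      simp only [mul_assoc]
    have e2 : z (h + 1) * (z s * (z h * (z (h + 1) * z m)))
        = z (h + 1) * (z s * z h) * z (h + 1) * z m := by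
      simp only [mul_assoc]
    rw [e1, e2, h1, h2]
    simp
  have hv := (mul_forms (c := c) (tailVec_anticomm hz (c l)) R).1
  simp only [forms]
  rw [mul_assoc, add_mul, add_mul, hv]
  simp only [mul_assoc, smul_mul_assoc, mul_smul_comm, hw, mul_zero, smul_zero, add_zero]

theorem forms_mul_tailVec :
    (forms z c (.node l L R)).1 * tailVec z (c l)
      = -((-1 : ℝ) ^ R.numNodes • ((forms z c L).1 * tailVec z (c l) *
        ((forms z c R).1 * ((-1 : ℝ) ^ R.numNodes • headVec z (c l))))) := by
  have hv := mul_forms (c := c) (tailVec_anticomm hz (c l)) R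
  have hw := anticomm_headVec (tailVec_anticomm hz (c l)) (c l)
  have hvv := tailVec_mul_self hz (c l)
  simp only [forms]
  generalize tailVec z (c l) = v at *
  generalize headVec z (c l) = w at *
  have h1 : v * (forms z c R).1 * v = 0 := by
    rw [hv.1, smul_mul_assoc, mul_assoc, hvv]; simp
  have h2 : v * ((forms z c R).2 * w) * v = 0 := by
    rw [mul_assoc, mul_assoc, ← neg_eq_iff_eq_neg.2 hw, mul_neg, mul_neg, ← mul_assoc,
      ← mul_assoc, hv.2, neg_mul (_ • _), smul_mul_assoc, mul_assoc _ v v, hvv]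
    simp
  have h3 : (forms z c R).1 * w * v = -((-1 : ℝ) ^ R.numNodes • (v * ((forms z c R).1 * w))) := by
    rw [← mul_assoc, hv.1, mul_assoc, ← neg_eq_iff_eq_neg.2 hw, smul_mul_assoc, smul_smul,
      ← mul_pow]
    simp [mul_assoc]
  rw [mul_assoc, add_mul, add_mul, h1, mul_smul_comm _ (forms z c R).1, smul_mul_assoc, h3,
    mul_smul_comm _ (forms z c R).2, mul_smul_comm _ v, smul_mul_assoc, h2]
  simp [mul_assoc]

/-- A positive functional on increasing products is positive on strictly positive elements. -/
theorem map_mul_apply_pos {φ : A →ₗ[ℝ] ℝ} {a n r : ℕ} (ha : a ≤ n + 1)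
    (hφ : ∀ S : List ℕ, S.Pairwise (· < ·) → (∀ s ∈ S, a ≤ s ∧ s ≤ n + 1) →
      0 ≤ φ (S.map z).prod ∧ (S.length = r + 1 → 0 < φ (S.map z).prod))
    {Q : Set ℕ} {x : A} (hx : StrictIn z a n Q r x) : 0 < φ (x * z (n + 1)) := by
  have h1 : StrictIn z a (n + 1) Set.univ (r + 1) (x * z (n + 1)) := by
    refine StrictIn.mul hz (c := n + 1) (Q := {s | s ≤ n}) (Q' := {n + 1}) (r' := 1) ?_ ?_ ha
      le_rfl ?_ (by simp) (by simp) rfl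
    · obtain ⟨t, ht, S, hS, hab, -, hr, y, hy, rfl⟩ := hx
      exact ⟨t, ht, S, hS, fun s hs => by have := hab s hs; omega, fun s hs => (hab s hs).2, hr,
        y, posCone_mono le_rfl (by omega) hy, rfl⟩
    · simpa using strictIn_prod (z := z) (S := [n + 1]) (a := n + 1) (b := n + 1) (Q := {n + 1})
        (r := 1) (by simp) (by simp) (by simp) rfl
    · simp
  obtain ⟨t, ht, S, hS, hab, -, hr, y, hy, hxy⟩ := h1
  have hy0 : 0 ≤ φ y := by
    clear hxy
    induction hy using AddSubmonoid.closure_induction with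
    | zero => simp
    | add x y _ _ hx hy => rw [map_add]; exact add_nonneg hx hy
    | mem x hx =>
      obtain ⟨u, hu, T, hT, hcd, rfl⟩ := hx
      rw [map_smul]
      exact mul_nonneg hu (hφ T hT hcd).1
  rw [hxy, map_add, map_smul]
  exact add_pos_of_pos_of_nonneg (mul_pos ht ((hφ S hS hab).2 hr)) hy0

/-- The quadratic inequality for a last top chord, in terms of a functional that is positive on
increasing products. -/
theorem quadratic_neg {h j : ℕ} (hT : Admissible c (.node l L R) 1 h) (hh : (c l).head = h)
    (hj1 : 1 ≤ j) (hj2 : j + 2 ≤ h) (hj : j ≠ (c l).tail) {φ : A →ₗ[ℝ] ℝ}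
    (hφ : ∀ S : List ℕ, S.Pairwise (· < ·) → (∀ s ∈ S, 1 ≤ s ∧ s ≤ h + 2) →
      0 ≤ φ (S.map z).prod ∧
      (S.length = (BinaryTree.node l L R).numNodes + 4 → 0 < φ (S.map z).prod)) {y : A}
    (hy : y = rowsProd z c (z (h + 2)) (.node l L R)) :
    φ (y * (z (c l).tail * (z j * (z (j + 1) * z (h + 2))))) *
        φ (y * (z ((c l).tail + 1) * (z h * (z (h + 1) * z (h + 2))))) -
      φ (y * (z ((c l).tail + 1) * (z j * (z (j + 1) * z (h + 2))))) *
        φ (y * (z (c l).tail * (z h * (z (h + 1) * z (h + 2))))) < 0 := by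
  obtain ⟨⟨ha, hth, -⟩, ⟨hα, hβ, hγ, hδ⟩, hsL, hsR, hAL, hAR, -⟩ := hT
  have hslope : ∀ m ∈ R.inorder, (c m).head = (c l).head → (c m).δ / (c m).γ
      < ((-1 : ℝ) ^ R.numNodes * (c l).δ) / ((-1 : ℝ) ^ R.numNodes * (c l).γ) := by
    simpa only [signed_ratio] using hsR
  subst hh
  set i := (c l).tail with hi
  set σ : ℝ := (-1 : ℝ) ^ R.numNodes with hσ
  have hσ2 : σ * σ = 1 := by rw [hσ, ← mul_pow]; simp
  have hzz := apply_mul_self_eq_zero hz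
  -- the two determinants on the right in terms of one positive number
  have hP := map_mul_apply_pos (r := (BinaryTree.node l L R).numNodes + 3)
    (n := (c l).head + 1) hz (by omega) hφ
    (x := (forms z c L).1 * ((forms z c R).1 * (z (c l).head * z ((c l).head + 1))) *
      (z i * z (i + 1))) (Q := Set.univ) (by
    refine StrictIn.mul_pair hz (r := L.numNodes + (R.numNodes + 2))
      (Q := {s | s < i ∨ i + 1 < s}) ha (by omega) ?_ (by simp)
      (by simp) (by simp) trivial trivial
    refine StrictIn.mul hz (strictIn_forms hz hAL i).1 (StrictIn.mul_pair hz
      (Q' := {s | i + 1 < s}) (by omega) le_rfl (strictIn_forms hz hAR i).1 ?_ ?_ ?_ ?_ ?_)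
      (by omega) (by omega) ?_ ?_ ?_ rfl <;> simp <;> omega)
  have hM := map_mul_apply_pos (r := (BinaryTree.node l L R).numNodes + 3)
    (n := (c l).head + 1) hz (by omega) hφ
    (x := (forms z c L).1 * tailVec z (c l) *
        ((forms z c R).1 * (σ • headVec z (c l))) * (z j * z (j + 1))) (Q := Set.univ) (by
    refine StrictIn.mul_pair hz (r := L.numNodes + (R.numNodes + 2))
      (Q := {s | s ≠ j ∧ s ≠ j + 1}) hj1 (by omega) ?_ (by simp)
      (by simp) (by simp) trivial trivial
    rw [signed_headVec]
    refine StrictIn.mul hz ((strictIn_forms hz hAL j).2 _ _ hα hβ hj hsL)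
      ((strictIn_forms hz hAR j).2 _ _ hγ hδ (by omega) hslope)
      (by omega) (by omega) ?_ ?_ ?_ (by omega) <;> simp
    omega)
  set P := φ ((forms z c L).1 * ((forms z c R).1 * (z (c l).head * z ((c l).head + 1))) *
      (z i * z (i + 1)) * z ((c l).head + 2)) with hPdef
  set M := φ ((forms z c L).1 * tailVec z (c l) *
        ((forms z c R).1 * (σ • headVec z (c l))) * (z j * z (j + 1)) * z ((c l).head + 2))
  have hcomm : z i * z (i + 1) * (z (c l).head * z ((c l).head + 1))
      = z (c l).head * z ((c l).head + 1) * (z i * z (i + 1)) :=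
    ((commute_pair_apply hz i (i + 1) _).mul_right (commute_pair_apply hz i (i + 1) _)).eq
  have hX1 : φ (y * (z (i + 1) * (z (c l).head * (z ((c l).head + 1) * z ((c l).head + 2)))))
      = σ * ((c l).α * P) := by
    have : tailVec z (c l) * z (i + 1) = (c l).α • (z i * z (i + 1)) := by
      rw [tailVec, add_mul, smul_mul_assoc, smul_mul_assoc, hzz]; simp [hi]
    rw [hy, rowsProd_mul hz, forms_mul_of_repeat hz rfl, this, smul_mul_assoc, hcomm, map_smul,
      mul_smul_comm, smul_mul_assoc, map_smul, hPdef]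
    simp only [mul_assoc, smul_eq_mul, hσ]
  have hX0 : φ (y * (z i * (z (c l).head * (z ((c l).head + 1) * z ((c l).head + 2)))))
      = -(σ * ((c l).β * P)) := by
    have : tailVec z (c l) * z i = -((c l).β • (z i * z (i + 1))) := by
      rw [tailVec, add_mul, smul_mul_assoc, smul_mul_assoc, hzz, hz (i + 1)]; simp [hi]
    rw [hy, rowsProd_mul hz, forms_mul_of_repeat hz rfl, this, neg_mul, smul_mul_assoc, hcomm,
      map_smul, mul_neg, mul_smul_comm, neg_mul, smul_mul_assoc, map_neg, map_smul, hPdef]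
    simp only [mul_assoc, smul_eq_mul, hσ, mul_neg]
  have hX : (c l).α * φ (y * (z i * (z j * (z (j + 1) * z ((c l).head + 2)))))
      + (c l).β * φ (y * (z (i + 1) * (z j * (z (j + 1) * z ((c l).head + 2))))) = -(σ * M) := by
    have hφs : ∀ (t : ℝ) (x : A), t * φ x = φ (t • x) := fun t x => by rw [map_smul, smul_eq_mul]
    rw [hφs, hφs, ← map_add, hy, rowsProd_mul hz, rowsProd_mul hz]
    have : (c l).α • ((forms z c (.node l L R)).1 *
          (z i * (z j * (z (j + 1) * z ((c l).head + 2)))))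
        + (c l).β • ((forms z c (.node l L R)).1 *
          (z (i + 1) * (z j * (z (j + 1) * z ((c l).head + 2)))))
        = (forms z c (.node l L R)).1 * tailVec z (c l)
          * (z j * z (j + 1)) * z ((c l).head + 2) := by
      simp only [tailVec, mul_add, add_mul, mul_smul_comm, smul_mul_assoc, mul_assoc, hi]
    rw [this, forms_mul_tailVec hz, neg_mul, neg_mul, smul_mul_assoc, smul_mul_assoc, map_neg,
      map_smul, smul_eq_mul]
  rw [hX1, hX0]
  have h1 : ∀ t₀ t₁ : ℝ, t₀ * (σ * ((c l).α * P)) - t₁ * -(σ * ((c l).β * P))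
      = σ * P * ((c l).α * t₀ + (c l).β * t₁) := fun t₀ t₁ => by ring
  rw [h1, hX]
  have h2 : σ * P * -(σ * M) = -(P * M) := by linear_combination (-P * M) * hσ2
  rw [h2, neg_lt_zero]
  exact mul_pos hP hM

end Quadratic

end DominoChord

/-! ### The forest of a chord diagram -/

namespace ChordDiagram

variable {n k : ℕ} (D : ChordDiagram n k)

/-- The chords of a diagram together with their domino variables. -/
def domino (α β γ δ ε : Fin k → ℝ) (l : Fin k) : DominoChord :=
  ⟨D.tail l, D.head l, α l, β l, γ l, δ l, ε l⟩

/-- The descendants of a chord, or all chords. -/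
def Scope : Option (Fin k) → Fin k → Prop
  | none, _ => True
  | some q, d => D.Descendant q d

/-- The first position available to the chords in a scope. -/
def scopeStart : Option (Fin k) → ℕ
  | none => 1
  | some q => D.tail q + 1

/-- The outermost chords of a scope: the children of a chord, or the top chords. -/
def Outermost : Option (Fin k) → Fin k → Prop
  | none, d => D.IsTop d
  | some q, d => D.IsParent q d

/-- The tree encodes outermost chords of a scope, and recursively their children. -/
def ParentTree : Option (Fin k) → BinaryTree (Fin k) → Prop
  | _, .nil => True
  | p, .node l L R => D.Outermost p l ∧ ParentTree p L ∧ ParentTree (some l) R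

/-- The tree `T` encodes the forest of the chords in a scope with tails before `b`. -/
structure Encodes (α β γ δ ε : Fin k → ℝ) (p : Option (Fin k)) (b : ℕ)
    (T : BinaryTree (Fin k)) : Prop where
  sorted : T.inorder.Pairwise (· < ·)
  mem_iff : ∀ m, m ∈ T.inorder ↔ D.Scope p m ∧ D.tail m < b
  admissible : DominoChord.Admissible (D.domino α β γ δ ε) T (D.scopeStart p) b
  epsPos : ∀ q, p = some q → DominoChord.EpsPos (D.domino α β γ δ ε) T
  parentTree : D.ParentTree p T

variable {D}

theorem Descendant.trans {l m d : Fin k} (h : D.Descendant l m) (h' : D.Descendant m d) :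
    D.Descendant l d := ⟨h.1.trans h'.1, h'.2.trans h.2⟩

theorem Descendant.scope {p : Option (Fin k)} {l d : Fin k} (h : D.Descendant l d)
    (hl : D.Scope p l) : D.Scope p d := by
  cases p with
  | none => trivial
  | some q => exact hl.trans h

theorem scopeStart_le {p : Option (Fin k)} {l : Fin k} (hl : D.Scope p l) :
    D.scopeStart p ≤ D.tail l := by
  cases p with
  | none => exact D.one_le_tail l
  | some q => exact hl.1

theorem head_le_of_tail_lt {l m : Fin k} (h : D.tail l < D.tail m) (h' : D.tail m < D.head l) :
    D.head m ≤ D.head l :=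
  not_lt.1 fun h'' => D.noncrossing l m (D.tail_strictMono.lt_iff_lt.1 h) ⟨h', h''⟩

theorem exists_isParent {l m : Fin k} (h : D.Descendant l m) : ∃ q, D.IsParent q m := by
  obtain ⟨q, hq, hmax⟩ := Finset.exists_max_image
    (Finset.univ.filter fun q => D.Descendant q m) D.tail ⟨l, by simpa using h⟩
  exact ⟨q, by simpa using hq, fun m' hm' => hmax m' (by simpa using hm')⟩

/-- Slopes decrease along chains of descendants with the same head. -/
theorem slope_lt_of_descendant {γ δ : Fin k → ℝ}
    (hs : ∀ l m, D.IsParent m l → D.head l = D.head m → δ l / γ l < δ m / γ m) {l m : Fin k}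
    (h : D.Descendant l m) (hh : D.head m = D.head l) : δ m / γ m < δ l / γ l := by
  induction m using WellFoundedLT.induction with
  | _ m ih =>
  obtain ⟨q, hq⟩ := exists_isParent h
  have hlq := hq.2 l h
  have hqm := hq.1
  rcases hlq.eq_or_lt with heq | hlt
  · obtain rfl := D.tail_strictMono.injective heq
    exact hs _ _ hq hh
  · have h1 := D.tail_add_two_le_head m
    have h2 : D.head q ≤ D.head l := head_le_of_tail_lt hlt (by have := hqm.1; omega)
    have h3 := hqm.2
    exact (hs _ _ hq (by omega)).trans
      (ih q (D.tail_strictMono.lt_iff_lt.1 hqm.1) ⟨hlt, h2⟩ (by omega))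

section Signs

variable {α β γ δ ε : Fin k → ℝ}

theorem Encodes.numNodes_eq {p : Option (Fin k)} {b : ℕ} {T : BinaryTree (Fin k)}
    (hT : D.Encodes α β γ δ ε p b T) {P : Fin k → Prop} [DecidablePred P]
    (hP : ∀ m, D.Scope p m ∧ D.tail m < b ↔ P m) :
    T.numNodes = (Finset.univ.filter P).card := by
  rw [← T.length_inorder, ← List.toFinset_card_of_nodup (hT.sorted.imp ne_of_lt)]
  congr 1
  ext m
  simp [hT.mem_iff, hP]

theorem Encodes.node (hs : D.SignRules α β γ δ ε) {p : Option (Fin k)} {b : ℕ} {l : Fin k}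
    {L R : BinaryTree (Fin k)} (hl : D.Scope p l) (hb : D.head l ≤ b) (ho : D.Outermost p l)
    (hbefore : ∀ d, D.Scope p d → D.tail d < D.tail l → D.head d ≤ D.tail l)
    (hafter : ∀ d, D.Scope p d → D.tail d < b → D.tail l < D.tail d → D.Descendant l d)
    (hL : D.Encodes α β γ δ ε p (D.tail l) L)
    (hR : D.Encodes α β γ δ ε (some l) (D.head l) R) :
    D.Encodes α β γ δ ε p b (.node l L R) := by
  obtain ⟨hα, hβ, hγ, hδ, -, hε, hsame, hht⟩ := hs
  have hlh := D.tail_add_two_le_head l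
  have hR' : R.numNodes = D.below l := hR.numNodes_eq fun m =>
    ⟨fun h => h.1, fun h => ⟨h, by have := D.tail_add_two_le_head m; have := h.2; omega⟩⟩
  have hLl : ∀ m ∈ L.inorder, m < l := fun m hm =>
    D.tail_strictMono.lt_iff_lt.1 ((hL.mem_iff m).1 hm).2
  have hlR : ∀ m ∈ R.inorder, l < m := fun m hm =>
    D.tail_strictMono.lt_iff_lt.1 ((hR.mem_iff m).1 hm).1.1
  refine ⟨?_, fun m => ?_, ⟨⟨scopeStart_le hl, hlh, hb⟩, ⟨hα l, hβ l, ?_, ?_⟩, ?_, ?_,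
    hL.admissible, hR.admissible, hR.epsPos l rfl⟩, ?_, ho, hL.parentTree, hR.parentTree⟩
  · refine List.pairwise_append.2 ⟨hL.sorted, List.pairwise_cons.2 ⟨hlR, hR.sorted⟩, ?_⟩
    intro m hm d hd
    rcases List.mem_cons.1 hd with rfl | hd
    · exact hLl m hm
    · exact (hLl m hm).trans (hlR d hd)
  · simp only [BinaryTree.inorder, List.mem_append, List.mem_cons, hL.mem_iff, hR.mem_iff]
    constructor
    · rintro (⟨h1, h2⟩ | rfl | ⟨h1, h2⟩)
      · exact ⟨h1, by omega⟩
      · exact ⟨hl, by omega⟩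
      · exact ⟨h1.scope hl, by omega⟩
    · rintro ⟨h1, h2⟩
      rcases lt_trichotomy (D.tail m) (D.tail l) with h | h | h
      · exact .inl ⟨h1, h⟩
      · exact .inr (.inl (D.tail_strictMono.injective h))
      · have h3 := hafter m h1 h2 h
        exact .inr (.inr ⟨h3, by have := D.tail_add_two_le_head m; have := h3.2; omega⟩)
  · rw [hR']; exact hγ l
  · rw [hR']; exact hδ l
  · exact fun m _ h => hht l m h
  · exact fun m hm h => slope_lt_of_descendant hsame ((hR.mem_iff m).1 hm).1 h
  · rintro q rfl
    refine ⟨?_, hL.epsPos q rfl⟩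
    rw [hL.numNodes_eq (P := fun m => D.Descendant q m ∧ D.tail m < D.tail l) fun m => Iff.rfl]
    exact hε l q ho

theorem exists_encodes (hs : D.SignRules α β γ δ ε) (p : Option (Fin k)) (b : ℕ)
    (hb : D.scopeStart p ≤ b) (hhead : ∀ d, D.Scope p d → D.tail d < b → D.head d ≤ b) :
    ∃ T, D.Encodes α β γ δ ε p b T := by
  induction hN : (Finset.univ.filter fun d => D.Scope p d ∧ D.tail d < b).card
    using Nat.strong_induction_on generalizing p b with
  | _ N ih =>
  subst hN
  rcases (Finset.univ.filter fun d => D.Scope p d ∧ D.tail d < b).eq_empty_or_nonempty with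
    h0 | hne
  · refine ⟨.nil, .nil, fun m => ?_, hb, fun _ _ => trivial, trivial⟩
    simpa [BinaryTree.inorder] using (Finset.filter_eq_empty_iff.1 h0 (Finset.mem_univ m))
  obtain ⟨e, he, hmax⟩ := Finset.exists_max_image _ D.head hne
  obtain ⟨l, hl, hmin⟩ := Finset.exists_min_image
    (Finset.univ.filter fun d => (D.Scope p d ∧ D.tail d < b) ∧ D.head d = D.head e) D.tail
    ⟨e, by simpa using he⟩
  simp only [Finset.mem_filter, Finset.mem_univ, true_and] at he hmax hl hmin
  obtain ⟨⟨hlp, hlb⟩, hle⟩ := hl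
  have hlh := D.tail_add_two_le_head l
  have hbefore : ∀ d, D.Scope p d → D.tail d < D.tail l → D.head d ≤ D.tail l := by
    intro d hd hdl
    by_contra! hlt
    have h1 := head_le_of_tail_lt hdl hlt
    have h2 := hmax d ⟨hd, by omega⟩
    have h3 := hmin d ⟨⟨hd, by omega⟩, by omega⟩
    omega
  have ho : D.Outermost p l := by
    have h1 : ∀ d, D.Scope p d → ¬ D.Descendant d l := fun d hd h => by
      have := hbefore d hd h.1
      have := h.2
      omega
    cases p with
    | none => exact fun d => h1 d trivial
    | some q =>
      refine ⟨hlp, fun d hd => ?_⟩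
      by_contra! hlt
      have := hlp.2
      have := hd.1
      exact h1 d ⟨hlt, head_le_of_tail_lt hlt (by omega)⟩ hd
  obtain ⟨L, hL⟩ := ih _ (Finset.card_lt_card <| by
    refine Finset.ssubset_iff_of_subset ?_ |>.2 ⟨l, by simp [hlp, hlb], by simp⟩
    intro d
    simp only [Finset.mem_filter, Finset.mem_univ, true_and]
    exact fun h => ⟨h.1, by omega⟩) p (D.tail l) (scopeStart_le hlp) hbefore rfl
  obtain ⟨R, hR⟩ := ih _ (Finset.card_lt_card <| by
    refine Finset.ssubset_iff_of_subset ?_ |>.2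
      ⟨l, by simp [hlp, hlb], by simp only [Finset.mem_filter]; exact fun h => lt_irrefl _ h.2.1.1⟩
    intro d
    simp only [Finset.mem_filter, Finset.mem_univ, true_and]
    have := hhead l hlp hlb
    exact fun h => ⟨Descendant.scope h.1 hlp, by omega⟩) (some l) (D.head l)
    (show D.tail l + 1 ≤ D.head l by omega) (fun d hd _ => hd.2) rfl
  refine ⟨.node l L R, .node hs hlp (hhead l hlp hlb) ho hbefore (fun d hd hdb hld => ?_) hL hR⟩
  exact ⟨hld, (hmax d ⟨hd, hdb⟩).trans hle.ge⟩

end Signs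

/-- The product of the domino rows, in terms of the tree. -/
theorem ParentTree.rowsProd_eq {A : Type*} [Ring A] [Algebra ℝ A] {z : ℕ → A}
    {c : Fin k → DominoChord} {r : Fin k → A} {u : Option (Fin k) → A}
    (hu : ∀ q, u (some q) = DominoChord.tailVec z (c q))
    (hr : ∀ p l, D.Outermost p l →
      r l = DominoChord.tailVec z (c l) + DominoChord.headVec z (c l) + (c l).ε • u p)
    {T : BinaryTree (Fin k)} {p : Option (Fin k)} (hT : D.ParentTree p T) :
    DominoChord.rowsProd z c (u p) T = (T.inorder.map r).prod := by
  induction T generalizing p with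
  | nil => rfl
  | node l L R hL hR =>
    obtain ⟨h1, h2, h3⟩ := hT
    rw [DominoChord.rowsProd, hL h2, ← hr p l h1, ← hu, hR h3]
    simp [BinaryTree.inorder, mul_assoc]

end ChordDiagram

/-! ### Twistors in the exterior algebra -/

section Exterior

/-- The determinant as a functional on the exterior algebra. -/
def detFunctional (r : ℕ) : ExteriorAlgebra ℝ (Fin r → ℝ) →ₗ[ℝ] ℝ :=
  ExteriorAlgebra.liftAlternating fun m =>
    if h : m = r then h ▸ Matrix.detRowAlternating else 0

theorem detFunctional_prod (r : ℕ) (v : Fin r → Fin r → ℝ) :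
    detFunctional r (List.ofFn fun i => ExteriorAlgebra.ι ℝ (v i)).prod
      = (Matrix.of v).det := by
  rw [← ExteriorAlgebra.ιMulti_apply, detFunctional,
    ExteriorAlgebra.liftAlternating_apply_ιMulti]
  simp only [dite_true]
  rfl

theorem detFunctional_prod_of_ne {m r : ℕ} (h : m ≠ r) (v : Fin m → Fin r → ℝ) :
    detFunctional r (List.ofFn fun i => ExteriorAlgebra.ι ℝ (v i)).prod = 0 := by
  rw [← ExteriorAlgebra.ιMulti_apply, detFunctional,
    ExteriorAlgebra.liftAlternating_apply_ιMulti]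
  simp [h]

variable {n : ℕ}

/-- The row of `Z` with a given marker, as an element of the exterior algebra. -/
def markerVec {r : ℕ} (Z : Matrix (Fin n) (Fin r) ℝ) (p : ℕ) :
    ExteriorAlgebra ℝ (Fin r → ℝ) := ExteriorAlgebra.ι ℝ (markerRow Z p)

theorem markerVec_anticomm {r : ℕ} (Z : Matrix (Fin n) (Fin r) ℝ) (a b : ℕ) :
    markerVec Z a * markerVec Z b = -(markerVec Z b * markerVec Z a) :=
  eq_neg_of_add_eq_zero_left (ExteriorAlgebra.ι_add_mul_swap _ _)

theorem markerVec_succ {r : ℕ} (Z : Matrix (Fin n) (Fin r) ℝ) (a : Fin n) :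
    markerVec Z (a + 1) = ExteriorAlgebra.ι ℝ (Z a) := by
  simp [markerVec, markerRow]

theorem detFunctional_markerVec {r : ℕ} {Z : Matrix (Fin n) (Fin r) ℝ} (hZ : IsPositiveMatrix Z)
    (S : List ℕ) (hS : S.Pairwise (· < ·)) (hmem : ∀ s ∈ S, 1 ≤ s ∧ s ≤ n) :
    0 ≤ detFunctional r (S.map (markerVec Z)).prod ∧
      (S.length = r → 0 < detFunctional r (S.map (markerVec Z)).prod) := by
  have hofFn : S.map (markerVec Z)
      = List.ofFn fun i : Fin S.length => ExteriorAlgebra.ι ℝ (markerRow Z (S.get i)) := by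
    conv_lhs => rw [← List.ofFn_get S, List.map_ofFn]
    rfl
  suffices h : S.length = r → 0 < detFunctional r (S.map (markerVec Z)).prod by
    refine ⟨?_, h⟩
    by_cases hr : S.length = r
    · exact (h hr).le
    · rw [hofFn, detFunctional_prod_of_ne hr]
  rintro rfl
  rw [hofFn, detFunctional_prod]
  have hlt : ∀ i : Fin S.length, S.get i - 1 < n := fun i => by
    have := hmem _ (S.get_mem i); omega
  convert hZ (fun i => ⟨S.get i - 1, hlt i⟩) fun i i' h => ?_
  · ext i q
    exact (congrFun (dif_pos (hlt i)) q).trans rfl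
  · have h1 := List.pairwise_iff_get.1 hS i i' h
    have h2 := hmem _ (S.get_mem i)
    exact Fin.mk_lt_mk.2 (by omega)

theorem twistor_eq {k : ℕ} (Z : Matrix (Fin n) (Fin (k + 4)) ℝ)
    (Y : Matrix (Fin k) (Fin (k + 4)) ℝ) (a b c d : ℕ) :
    twistor Z Y ![a, b, c, d] = detFunctional (k + 4)
      ((List.ofFn fun m => ExteriorAlgebra.ι ℝ (Y m)).prod *
        (markerVec Z a * (markerVec Z b * (markerVec Z c * markerVec Z d)))) := by
  have h1 : (List.ofFn fun m => ExteriorAlgebra.ι ℝ (Y m)).prod *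
        (markerVec Z a * (markerVec Z b * (markerVec Z c * markerVec Z d)))
      = (List.ofFn fun i => ExteriorAlgebra.ι ℝ
          (Fin.append Y (fun t => markerRow Z (![a, b, c, d] t)) i)).prod := by
    have : (fun i => ExteriorAlgebra.ι ℝ
          (Fin.append Y (fun t => markerRow Z (![a, b, c, d] t)) i))
        = Fin.append (fun m => ExteriorAlgebra.ι ℝ (Y m))
          fun t => markerVec Z (![a, b, c, d] t) := by
      ext i
      refine Fin.addCases (m := k) (n := 4) (fun i => ?_) (fun i => ?_) i
      · simp only [Fin.append_left]
        exact congrArg _ (Fin.append_left (α := Fin (k + 4) → ℝ) _ _ i)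
      · simp only [Fin.append_right, markerVec]
        exact congrArg _ (Fin.append_right (α := Fin (k + 4) → ℝ) _ _ i)
    rw [this, List.ofFn_fin_append, List.prod_append]
    simp [List.ofFn_succ]
  rw [h1, detFunctional_prod, twistor]
  congr 1
  ext i q
  refine Fin.addCases (m := k) (n := 4) (fun i => ?_) (fun i => ?_) i
  · simpa using (congrFun (Fin.append_left (α := Fin (k + 4) → ℝ) Y _ i) q).symm
  · simpa using (congrFun (Fin.append_right (α := Fin (k + 4) → ℝ) Y
      (fun t => markerRow Z (![a, b, c, d] t)) i) q).symm

theorem sum_ite_smul_ι {r : ℕ} (Z : Matrix (Fin n) (Fin r) ℝ) {p : ℕ} (h1 : 1 ≤ p) (h2 : p ≤ n)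
    (x : ℝ) : ∑ a : Fin n, (if (a : ℕ) + 1 = p then x else 0) • ExteriorAlgebra.ι ℝ (Z a)
      = x • markerVec Z p := by
  obtain ⟨p, rfl⟩ := Nat.exists_eq_add_of_le' h1
  rw [Finset.sum_eq_single (⟨p, by omega⟩ : Fin n)]
  · simp [← markerVec_succ]
  · intro a _ ha
    rw [if_neg fun h => ha (Fin.ext (by simpa using h)), zero_smul]
  · simp

/-- The vector inherited by the outermost chords of a scope. -/
def ChordDiagram.inherited {k r : ℕ} (Z : Matrix (Fin n) (Fin r) ℝ) (c : Fin k → DominoChord) :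
    Option (Fin k) → ExteriorAlgebra ℝ (Fin r → ℝ)
  | none => markerVec Z n
  | some q => DominoChord.tailVec (markerVec Z) (c q)

theorem ChordDiagram.ι_dominoMatrix_mul {k r : ℕ} (D : ChordDiagram n k) (α β γ δ ε : Fin k → ℝ)
    (Z : Matrix (Fin n) (Fin r) ℝ) (p : Option (Fin k)) (l : Fin k) (h : D.Outermost p l) :
    ExteriorAlgebra.ι ℝ ((D.dominoMatrix α β γ δ ε * Z) l)
      = DominoChord.tailVec (markerVec Z) (D.domino α β γ δ ε l)
        + DominoChord.headVec (markerVec Z) (D.domino α β γ δ ε l)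
        + ε l • ChordDiagram.inherited Z (D.domino α β γ δ ε) p := by
  have hrow : (D.dominoMatrix α β γ δ ε * Z) l = ∑ a, D.dominoMatrix α β γ δ ε l a • Z a := by
    ext q
    simp [Matrix.mul_apply, Finset.sum_apply]
  have hb := fun m => D.one_le_tail m
  have hb' := fun m => D.tail_add_two_le_head m
  have hb'' := fun m => D.head_add_two_le m
  have hbl := hb l
  have hbl' := hb' l
  have hbl'' := hb'' l
  rw [hrow, map_sum]
  simp only [map_smul]
  cases p with
  | none =>
    have hnp : ∀ m, ¬ D.IsParent m l := fun m hm => h m hm.1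
    have htop : D.IsTop l := h
    simp only [dominoMatrix, Matrix.of_apply, hnp, htop, true_and, if_false,
      Finset.sum_const_zero, add_zero, add_smul, Finset.sum_add_distrib]
    rw [sum_ite_smul_ι Z (by omega) (by omega), sum_ite_smul_ι Z (by omega) (by omega),
      sum_ite_smul_ι Z (by omega) (by omega), sum_ite_smul_ι Z (by omega) (by omega),
      sum_ite_smul_ι Z (by omega) (by omega)]
    simp only [DominoChord.tailVec, DominoChord.headVec, domino, inherited]
    abel
  | some q =>
    have hp : D.IsParent q l := h
    have hntop : ¬ D.IsTop l := fun ht => ht q hp.1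
    have hpu : ∀ m, D.IsParent m l ↔ m = q := fun m =>
      ⟨fun hm => D.tail_strictMono.injective (le_antisymm (hp.2 m hm.1) (hm.2 q hp.1)),
        fun hm => hm ▸ hp⟩
    have hbq := hb q
    have hbq' := hb' q
    have hbq'' := hb'' q
    simp only [dominoMatrix, Matrix.of_apply, hpu, hntop, false_and, if_false,
      Finset.sum_ite_eq', Finset.mem_univ, if_true, add_zero, add_smul, Finset.sum_add_distrib]
    rw [sum_ite_smul_ι Z (by omega) (by omega), sum_ite_smul_ι Z (by omega) (by omega),
      sum_ite_smul_ι Z (by omega) (by omega), sum_ite_smul_ι Z (by omega) (by omega),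
      sum_ite_smul_ι Z (by omega) (by omega), sum_ite_smul_ι Z (by omega) (by omega)]
    simp only [DominoChord.tailVec, DominoChord.headVec, domino, inherited, smul_add, smul_smul]
    abel

end Exterior
/-- Let `D` be a chord diagram with a top chord `(i, i+1, n-2, n-1)`,
`C` a domino matrix of `D` satisfying the sign rules, `Z` positive, `Y = C * Z`.
Then for every `1 ≤ j ≤ n - 4` with `j ≠ i`:
`⟨Y i j (j+1) n⟩·⟨Y (i+1) (n-2) (n-1) n⟩ − ⟨Y (i+1) j (j+1) n⟩·⟨Y i (n-2) (n-1) n⟩ < 0`. -/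
theorem quad_functionary_negative_for_top_chord
    (n k : ℕ) (hk : 1 ≤ k) (hn : k + 4 ≤ n)
    (D : ChordDiagram n k) (l : Fin k) (hl : D.IsTop l) (hhead : D.head l = n - 2)
    (α β γ δ ε : Fin k → ℝ) (hs : D.SignRules α β γ δ ε)
    (Z : Matrix (Fin n) (Fin (k + 4)) ℝ) (hZ : IsPositiveMatrix Z)
    (Y : Matrix (Fin k) (Fin (k + 4)) ℝ) (hY : Y = D.dominoMatrix α β γ δ ε * Z)
    (j : ℕ) (hj1 : 1 ≤ j) (hj2 : j ≤ n - 4) (hji : j ≠ D.tail l) :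
    twistor Z Y ![D.tail l, j, j + 1, n] *
          twistor Z Y ![D.tail l + 1, n - 2, n - 1, n] -
        twistor Z Y ![D.tail l + 1, j, j + 1, n] *
          twistor Z Y ![D.tail l, n - 2, n - 1, n] < 0 := by
  obtain ⟨h, rfl⟩ : ∃ h, n = h + 2 := ⟨n - 2, by omega⟩
  simp only [Nat.add_sub_cancel, show h + 2 - 1 = h + 1 from rfl] at *
  have hmax := fun d => D.head_add_two_le d
  have hgap := fun d => D.tail_add_two_le_head d
  have hbefore : ∀ d, D.Scope none d → D.tail d < D.tail l → D.head d ≤ D.tail l := by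
    intro d _ hd
    by_contra! hlt
    exact hl d ⟨hd, ChordDiagram.head_le_of_tail_lt hd hlt⟩
  obtain ⟨L, hL⟩ := ChordDiagram.exists_encodes hs none (D.tail l) (D.one_le_tail l) hbefore
  obtain ⟨R, hR⟩ := ChordDiagram.exists_encodes hs (some l) (D.head l)
    (show D.tail l + 1 ≤ D.head l by have := hgap l; omega) fun d hd _ => hd.2
  have hT := ChordDiagram.Encodes.node hs (p := none) (b := h) trivial hhead.le hl hbefore
    (fun d _ _ hld => ⟨hld, by have := hmax d; omega⟩) hL hR
  have hlist : (BinaryTree.node l L R).inorder = List.finRange k := by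
    refine List.Perm.eq_of_pairwise' hT.sorted (List.pairwise_lt_finRange k) ?_
    refine (List.perm_ext_iff_of_nodup (hT.sorted.imp ne_of_lt) (List.nodup_finRange k)).2
      fun m => ?_
    have := hmax m
    have := hgap m
    simp only [hT.mem_iff, List.mem_finRange, iff_true]
    exact ⟨trivial, by omega⟩
  have hnum : (BinaryTree.node l L R).numNodes = k := by
    rw [← BinaryTree.length_inorder, hlist, List.length_finRange]
  have hprod : (List.ofFn fun m => ExteriorAlgebra.ι ℝ (Y m)).prod
      = DominoChord.rowsProd (markerVec Z) (D.domino α β γ δ ε) (markerVec Z (h + 2))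
        (.node l L R) := by
    rw [List.ofFn_eq_map, ← hlist, hY]
    exact (ChordDiagram.ParentTree.rowsProd_eq (u := ChordDiagram.inherited Z _) (fun _ => rfl)
      (fun p m hm => D.ι_dominoMatrix_mul α β γ δ ε Z p m hm) hT.parentTree).symm
  simp only [twistor_eq]
  refine DominoChord.quadratic_neg (markerVec_anticomm Z) hT.admissible hhead hj1 (by omega) hji
    (fun S hS hmem => ?_) hprod
  rw [hnum]
  exact detFunctional_markerVec hZ S hS hmem

end
end

section
/- Let D ∈ CD_{n,k} be a chord diagram and let C be a domino matrix of D satisfying the sign rules. Then C is totally nonnegative of rank k (all k×k minors of C are nonnegative and C has rank k). Moreover, for every k-element subset I ⊆ [n], whether det(C^I) = 0 depends only on D and I and not on the choice of the variables satisfying the sign rules: if C and C′ are two domino matrices of D both satisfying the sign rules, then det(C^I) = 0 if and only if det(C′^I) = 0. -/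
open scoped Classical

noncomputable section

/-- Two reals are both positive or both zero. -/
def SamePos (x y : ℝ) : Prop := (0 < x ∧ 0 < y) ∨ (x = 0 ∧ y = 0)

theorem SamePos.zero : SamePos 0 0 := Or.inr ⟨rfl, rfl⟩

theorem SamePos.nonneg {x y : ℝ} (h : SamePos x y) : 0 ≤ x := by
  rcases h with h | h
  · exact h.1.le
  · exact h.1.ge

theorem SamePos.eq_zero_iff {x y : ℝ} (h : SamePos x y) : x = 0 ↔ y = 0 := by
  rcases h with h | h
  · simp [h.1.ne', h.2.ne']
  · simp [h]

theorem SamePos.mul {x y x' y' : ℝ} (h : SamePos x x') (h' : SamePos y y') :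
    SamePos (x * y) (x' * y') := by
  rcases h with ⟨h1, h2⟩ | ⟨rfl, rfl⟩
  · rcases h' with ⟨h3, h4⟩ | ⟨rfl, rfl⟩
    · exact Or.inl ⟨mul_pos h1 h3, mul_pos h2 h4⟩
    · exact Or.inr (by simp)
  · exact Or.inr (by simp)

theorem SamePos.add_mul {x y x' y' t t' : ℝ} (ht : 0 < t) (ht' : 0 < t')
    (h : SamePos x x') (h' : SamePos y y') : SamePos (x + t * y) (x' + t' * y') := by
  rcases h with ⟨h1, h2⟩ | ⟨rfl, rfl⟩
  · rcases h' with ⟨h3, h4⟩ | ⟨rfl, rfl⟩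
    · exact Or.inl ⟨by positivity, by positivity⟩
    · exact Or.inl (by simp [h1, h2])
  · simpa using SamePos.mul (Or.inl ⟨ht, ht'⟩) h'

/-- The minor of the array `r` on the `m` consecutive rows from row `s` on and the columns `g`. -/
def minorFrom (s m : ℕ) (r : ℕ → ℕ → ℝ) (g : Fin m → ℕ) : ℝ :=
  (Matrix.of fun i j : Fin m => r (s + i) (g j)).det

/-- On the rows `s, …, s + m - 1`, the maximal minors of `r` and of `r'` are nonnegative, and
vanish for the same sets of columns. -/
def SamePositroid (s m : ℕ) (r r' : ℕ → ℕ → ℝ) : Prop :=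
  ∀ g : Fin m → ℕ, StrictMono g → SamePos (minorFrom s m r g) (minorFrom s m r' g)

theorem minorFrom_congr {s m : ℕ} {r r₂ : ℕ → ℕ → ℝ} {g g₂ : Fin m → ℕ}
    (h : ∀ (i : ℕ) (j : Fin m), s ≤ i → i < s + m → r₂ i (g₂ j) = r i (g j)) :
    minorFrom s m r₂ g₂ = minorFrom s m r g := by
  unfold minorFrom
  congr 1
  ext i j
  exact h _ j (by omega) (by omega)

theorem minorFrom_eq_zero {s m : ℕ} {r : ℕ → ℕ → ℝ} {g : Fin m → ℕ} (j : Fin m)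
    (h : ∀ i, s ≤ i → i < s + m → r i (g j) = 0) : minorFrom s m r g = 0 :=
  Matrix.det_eq_zero_of_column_eq_zero j fun i => h _ (by omega) (by omega)

theorem minorFrom_update {s m : ℕ} {r r₂ : ℕ → ℕ → ℝ} {g : Fin m → ℕ} (hg : StrictMono g)
    (k : Fin m) (u : ℝ) (p : ℕ) (t : ℝ)
    (hk : ∀ i, s ≤ i → i < s + m → r₂ i (g k) = u * r i (g k) + t * r i p)
    (h : ∀ i j, s ≤ i → i < s + m → j ≠ g k → r₂ i j = r i j) :
    minorFrom s m r₂ g = u * minorFrom s m r g + t * minorFrom s m r (Function.update g k p) := by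
  unfold minorFrom
  have e : (Matrix.of fun i j : Fin m => r₂ (s + i) (g j)) =
      (Matrix.of fun i j : Fin m => r (s + i) (g j)).updateCol k
        ((u • fun i : Fin m => r (s + i) (g k)) + t • fun i : Fin m => r (s + i) p) := by
    ext i j
    by_cases hj : j = k
    · subst hj
      simp [hk (s + i) (by omega) (by omega)]
    · simp [hj,
        h (s + i) (g j) (by omega) (by omega) (fun hh => hj (hg.injective hh))]
  have e1 : (Matrix.of fun i j : Fin m => r (s + i) (g j)).updateCol k
      (fun i : Fin m => r (s + i) (g k)) = (Matrix.of fun i j : Fin m => r (s + i) (g j)) := by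
    ext i j
    by_cases hj : j = k
    · subst hj; simp
    · simp [hj]
  have e2 : (Matrix.of fun i j : Fin m => r (s + i) (g j)).updateCol k
      (fun i : Fin m => r (s + i) p) =
      (Matrix.of fun i j : Fin m => r (s + i) (Function.update g k p j)) := by
    ext i j
    by_cases hj : j = k
    · subst hj; simp
    · simp [hj]
  rw [e, Matrix.det_updateCol_add, Matrix.det_updateCol_smul, Matrix.det_updateCol_smul, e1, e2]

namespace SamePositroid

variable {s m : ℕ} {r r' : ℕ → ℕ → ℝ}

theorem congr {r₂ r₂' : ℕ → ℕ → ℝ} (H : SamePositroid s m r r')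
    (h : ∀ i j, s ≤ i → i < s + m → r₂ i j = r i j)
    (h' : ∀ i j, s ≤ i → i < s + m → r₂' i j = r' i j) : SamePositroid s m r₂ r₂' := by
  intro g hg
  rw [minorFrom_congr (r := r) (g := g) fun i j => h i (g j),
    minorFrom_congr (r := r') (g := g) fun i j => h' i (g j)]
  exact H g hg

theorem pullback (H : SamePositroid s m r r') (S : ℕ → Prop) (φ : ℕ → ℕ)
    (hφ : ∀ j j', S j → S j' → j < j' → φ j < φ j') :
    SamePositroid s m (fun i j => if S j then r i (φ j) else 0)
      (fun i j => if S j then r' i (φ j) else 0) := by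
  intro g hg
  by_cases hS : ∀ j, S (g j)
  · have key : ∀ r : ℕ → ℕ → ℝ, minorFrom s m (fun i j => if S j then r i (φ j) else 0) g =
        minorFrom s m r (φ ∘ g) := fun r => minorFrom_congr fun i j _ _ => by simp [hS]
    rw [key r, key r']
    exact H _ fun i j hij => hφ _ _ (hS i) (hS j) (hg hij)
  · push Not at hS
    obtain ⟨j, hj⟩ := hS
    rw [minorFrom_eq_zero j (fun i _ _ => by simp [hj]),
      minorFrom_eq_zero j (fun i _ _ => by simp [hj])]
    exact SamePos.zero

theorem scaleCol (H : SamePositroid s m r r') (q : ℕ) {t t' : ℝ} (ht : 0 < t) (ht' : 0 < t') :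
    SamePositroid s m (fun i j => if j = q then t * r i q else r i j)
      (fun i j => if j = q then t' * r' i q else r' i j) := by
  intro g hg
  by_cases hq : ∃ k, g k = q
  · obtain ⟨k, rfl⟩ := hq
    have key : ∀ (t : ℝ) (r : ℕ → ℕ → ℝ),
        minorFrom s m (fun i j => if j = g k then t * r i (g k) else r i j) g =
          t * minorFrom s m r g := fun t r => by
      rw [minorFrom_update (r := r) hg k t 0 0 (by intros; simp) (by intros; simp_all)]
      ring
    rw [key t r, key t' r']
    exact SamePos.mul (Or.inl ⟨ht, ht'⟩) (H g hg)
  · push Not at hq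
    have key : ∀ (t : ℝ) (r : ℕ → ℕ → ℝ),
        minorFrom s m (fun i j => if j = q then t * r i q else r i j) g = minorFrom s m r g :=
      fun t r => minorFrom_congr fun i j _ _ => by simp [hq j]
    rw [key t r, key t' r']
    exact H g hg

/-- Adding a positive multiple of a column to a column from which it is separated by zero
columns only. -/
theorem addCol (H : SamePositroid s m r r') (p q : ℕ) {t t' : ℝ} (ht : 0 < t) (ht' : 0 < t')
    (hpq : p ≠ q)
    (hz : ∀ i j, s ≤ i → i < s + m → (p < j ∧ j < q ∨ q < j ∧ j < p) → r i j = 0 ∧ r' i j = 0) :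
    SamePositroid s m (fun i j => if j = q then r i q + t * r i p else r i j)
      (fun i j => if j = q then r' i q + t' * r' i p else r' i j) := by
  intro g hg
  by_cases hq : ∃ k, g k = q
  · obtain ⟨k, rfl⟩ := hq
    have key : ∀ (t : ℝ) (r : ℕ → ℕ → ℝ),
        minorFrom s m (fun i j => if j = g k then r i (g k) + t * r i p else r i j) g =
          minorFrom s m r g + t * minorFrom s m r (Function.update g k p) := fun t r => by
      rw [minorFrom_update (r := r) hg k 1 p t (by intros; simp) (by intros; simp_all), one_mul]
    rw [key t r, key t' r']
    refine SamePos.add_mul ht ht' (H g hg) ?_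
    by_cases hp : ∃ l, g l = p
    · obtain ⟨l, rfl⟩ := hp
      have hlk : l ≠ k := fun h => hpq (by rw [h])
      have key : ∀ r : ℕ → ℕ → ℝ, minorFrom s m r (Function.update g k (g l)) = 0 := fun r =>
        Matrix.det_zero_of_column_eq hlk fun i => by simp [hlk]
      rw [key, key]
      exact SamePos.zero
    · push Not at hp
      by_cases hb : ∃ l, p < g l ∧ g l < g k ∨ g k < g l ∧ g l < p
      · obtain ⟨l, hl⟩ := hb
        have hlk : l ≠ k := by rintro rfl; omega
        rw [minorFrom_eq_zero l (fun i h1 h2 => by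
            simpa [hlk] using (hz i _ h1 h2 hl).1),
          minorFrom_eq_zero l (fun i h1 h2 => by
            simpa [hlk] using (hz i _ h1 h2 hl).2)]
        exact SamePos.zero
      · push Not at hb
        apply H
        intro i j hij
        have hij' := hg hij
        by_cases hi : i = k
        · subst hi
          have hj : j ≠ i := hij.ne'
          have := hb j
          have := hp j
          simp only [Function.update_self, Function.update_of_ne hj]
          omega
        · by_cases hj : j = k
          · subst hj
            have := hb i
            have := hp i
            simp only [Function.update_self, Function.update_of_ne hi]
            omega
          · simpa [hi, hj] using hij'
  · push Not at hq
    have key : ∀ (t : ℝ) (r : ℕ → ℕ → ℝ),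
        minorFrom s m (fun i j => if j = q then r i q + t * r i p else r i j) g = minorFrom s m r g :=
      fun t r => minorFrom_congr fun i j _ _ => by simp [hq j]
    rw [key t r, key t' r']
    exact H g hg

end SamePositroid

theorem minorFrom_snoc {s m : ℕ} (r : ℕ → ℕ → ℝ) (g : Fin m → ℕ) (p : ℕ) :
    minorFrom s (m + 1) r (Fin.snoc g p : Fin (m + 1) → ℕ) =
      (-1) ^ m * minorFrom s (m + 1) r (Fin.cons p g : Fin (m + 1) → ℕ) := by
  unfold minorFrom
  have h := Matrix.det_permute' (finRotate (m + 1))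
    (Matrix.of fun i j : Fin (m + 1) => r (s + i) ((Fin.cons p g : Fin (m + 1) → ℕ) j))
  rw [sign_finRotate] at h
  push_cast at h
  rw [← h]
  congr 1
  ext i j
  simp only [Matrix.submatrix_apply, Matrix.of_apply, id]
  congr 1
  refine Fin.lastCases ?_ (fun j => ?_) j
  · simp
  · simp [finRotate_apply, Fin.coeSucc_eq_succ]

theorem minorFrom_directSum {s p q : ℕ} {r : ℕ → ℕ → ℝ} {t : ℕ}
    (hA : ∀ i j, s ≤ i → i < s + p → t ≤ j → r i j = 0)
    (hB : ∀ i j, s + p ≤ i → i < s + p + q → j < t → r i j = 0)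
    {g : Fin (p + q) → ℕ} (hg : StrictMono g) :
    minorFrom s (p + q) r g = minorFrom s p r (g ∘ Fin.castAdd q) *
      minorFrom (s + p) q r (g ∘ Fin.natAdd p) := by
  unfold minorFrom
  rw [← Matrix.det_submatrix_equiv_self (finSumFinEquiv (m := p) (n := q))]
  set M := (Matrix.of fun i j : Fin (p + q) => r (s + i) (g j)).submatrix
    (finSumFinEquiv (m := p) (n := q)) finSumFinEquiv with hM
  have h11 : M.toBlocks₁₁ = Matrix.of fun i j : Fin p => r (s + i) ((g ∘ Fin.castAdd q) j) := by
    ext i j; simp [hM, Matrix.toBlocks₁₁]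
  have h22 : M.toBlocks₂₂ =
      Matrix.of fun i j : Fin q => r (s + p + i) ((g ∘ Fin.natAdd p) j) := by
    ext i j; simp [hM, Matrix.toBlocks₂₂, add_assoc]
  rw [← h11, ← h22, ← Matrix.fromBlocks_toBlocks M]
  by_cases h : ∃ j : Fin q, g (Fin.natAdd p j) < t
  · obtain ⟨j₀, hj₀⟩ := h
    have h21 : M.toBlocks₂₁ = 0 := by
      ext i j
      simp only [hM, Matrix.toBlocks₂₁, Matrix.of_apply, Matrix.submatrix_apply,
        finSumFinEquiv_apply_left, finSumFinEquiv_apply_right, Matrix.zero_apply]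
      refine hB _ _ (by rw [Fin.val_natAdd]; omega) (by rw [Fin.val_natAdd]; omega) (lt_trans (hg ?_) hj₀)
      rw [Fin.lt_def]; simp; omega
    rw [h21, Matrix.det_fromBlocks_zero₂₁, Matrix.toBlocks_fromBlocks₁₁,
      Matrix.toBlocks_fromBlocks₂₂]
  · push Not at h
    have h12 : M.toBlocks₁₂ = 0 := by
      ext i j
      simp only [hM, Matrix.toBlocks₁₂, Matrix.of_apply, Matrix.submatrix_apply,
        finSumFinEquiv_apply_left, finSumFinEquiv_apply_right, Matrix.zero_apply]
      exact hA _ _ (by simp) (by simp) (h j)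
    rw [h12, Matrix.det_fromBlocks_zero₁₂, Matrix.toBlocks_fromBlocks₁₁,
      Matrix.toBlocks_fromBlocks₂₂]

namespace SamePositroid

variable {s m : ℕ} {r r' : ℕ → ℕ → ℝ}

theorem directSum {p q : ℕ} (t : ℕ) (H : SamePositroid s p r r')
    (H' : SamePositroid (s + p) q r r')
    (hA : ∀ i j, s ≤ i → i < s + p → t ≤ j → r i j = 0 ∧ r' i j = 0)
    (hB : ∀ i j, s + p ≤ i → i < s + p + q → j < t → r i j = 0 ∧ r' i j = 0) :
    SamePositroid s (p + q) r r' := by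
  intro g hg
  rw [minorFrom_directSum (fun i j h1 h2 h3 => (hA i j h1 h2 h3).1)
      (fun i j h1 h2 h3 => (hB i j h1 h2 h3).1) hg,
    minorFrom_directSum (fun i j h1 h2 h3 => (hA i j h1 h2 h3).2)
      (fun i j h1 h2 h3 => (hB i j h1 h2 h3).2) hg]
  exact SamePos.mul (H _ (hg.comp (Fin.strictMono_castAdd q)))
    (H' _ (hg.comp (Fin.strictMono_natAdd p)))

/-- Cyclic shift of the first column `p` to the last position `q`. -/
theorem moveToBack (H : SamePositroid s (m + 1) r r') (p q : ℕ) (hpq : p < q)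
    (hz : ∀ i j, s ≤ i → i < s + (m + 1) → (j < p ∨ q < j) → r i j = 0 ∧ r' i j = 0) :
    SamePositroid s (m + 1)
      (fun i j => if j = q then (-1) ^ m * r i p else if j = p then 0 else r i j)
      (fun i j => if j = q then (-1) ^ m * r' i p else if j = p then 0 else r' i j) := by
  intro g hg
  by_cases h0 : ∃ k, g k ≤ p ∨ q < g k
  · obtain ⟨k, hk⟩ := h0
    have hkq : g k ≠ q := by omega
    rw [minorFrom_eq_zero k (fun i h1 h2 => by
        by_cases hkp : g k = p
        · simp [hkp, hpq.ne]
        · simpa [hkq, hkp] using (hz i (g k) h1 h2 (by omega)).1),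
      minorFrom_eq_zero k (fun i h1 h2 => by
        by_cases hkp : g k = p
        · simp [hkp, hpq.ne]
        · simpa [hkq, hkp] using (hz i (g k) h1 h2 (by omega)).2)]
    exact SamePos.zero
  · push Not at h0
    by_cases hq : g (Fin.last m) = q
    · have hlt : ∀ k : Fin m, g k.castSucc < q := fun k => hq ▸ hg (Fin.castSucc_lt_last k)
      have key : ∀ r : ℕ → ℕ → ℝ, minorFrom s (m + 1)
          (fun i j => if j = q then (-1) ^ m * r i p else if j = p then 0 else r i j) g =
          minorFrom s (m + 1) r (Fin.cons p (Fin.init g) : Fin (m + 1) → ℕ) := by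
        intro r
        have e : Function.update g (Fin.last m) p = (Fin.snoc (Fin.init g) p : Fin (m + 1) → ℕ) := by
          funext k
          refine Fin.lastCases ?_ (fun k => ?_) k
          · simp
          · simp [Fin.init, (Fin.castSucc_lt_last k).ne]
        have e3 : minorFrom s (m + 1)
          (fun i j => if j = q then (-1) ^ m * r i p else if j = p then 0 else r i j) g =
          minorFrom s (m + 1) (fun i j => if j = q then (-1) ^ m * r i p else r i j) g :=
          minorFrom_congr fun i k _ _ => by
            have := (h0 k).1
            by_cases h : g k = q <;> simp [h, this.ne']
        rw [e3, minorFrom_update (r := r) hg (Fin.last m) 0 p ((-1) ^ m) (by intros; simp [hq])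
          (by intros; simp_all), e, minorFrom_snoc, ← mul_assoc, ← mul_pow]
        simp
      rw [key, key]
      refine H _ ?_
      intro i j hij
      obtain ⟨j, rfl⟩ := Fin.exists_succ_eq.2 (Fin.ne_zero_of_lt hij)
      refine Fin.cases ?_ (fun i hij => ?_) i hij
      · intro _
        simpa [Fin.init] using (h0 j.castSucc).1
      · simpa [Fin.init] using hg (Fin.castSucc_lt_castSucc_iff.2 (Fin.succ_lt_succ_iff.1 hij))
    · have hne : ∀ k, g k ≠ q := by
        intro k hk
        have := hg.monotone (Fin.le_last k)
        have := (h0 (Fin.last m)).2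
        omega
      have hne' : ∀ k, g k ≠ p := fun k => (h0 k).1.ne'
      have key : ∀ r : ℕ → ℕ → ℝ, minorFrom s (m + 1)
          (fun i j => if j = q then (-1) ^ m * r i p else if j = p then 0 else r i j) g =
          minorFrom s (m + 1) r g :=
        fun r => minorFrom_congr fun i j _ _ => by simp [hne j, hne' j]
      rw [key r, key r']
      exact H g hg

/-- Cyclic shift of the last column `p` to the first position `q`. -/
theorem moveToFront (H : SamePositroid s (m + 1) r r') (p q : ℕ) (hpq : q < p)
    (hz : ∀ i j, s ≤ i → i < s + (m + 1) → (j < q ∨ p < j) → r i j = 0 ∧ r' i j = 0) :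
    SamePositroid s (m + 1)
      (fun i j => if j = q then (-1) ^ m * r i p else if j = p then 0 else r i j)
      (fun i j => if j = q then (-1) ^ m * r' i p else if j = p then 0 else r' i j) := by
  intro g hg
  by_cases h0 : ∃ k, g k < q ∨ p ≤ g k
  · obtain ⟨k, hk⟩ := h0
    have hkq : g k ≠ q := by omega
    rw [minorFrom_eq_zero k (fun i h1 h2 => by
        by_cases hkp : g k = p
        · simp [hkp, hpq.ne']
        · simpa [hkq, hkp] using (hz i (g k) h1 h2 (by omega)).1),
      minorFrom_eq_zero k (fun i h1 h2 => by
        by_cases hkp : g k = p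
        · simp [hkp, hpq.ne']
        · simpa [hkq, hkp] using (hz i (g k) h1 h2 (by omega)).2)]
    exact SamePos.zero
  · push Not at h0
    by_cases hq : g 0 = q
    · have key : ∀ r : ℕ → ℕ → ℝ, minorFrom s (m + 1)
          (fun i j => if j = q then (-1) ^ m * r i p else if j = p then 0 else r i j) g =
          minorFrom s (m + 1) r (Fin.snoc (Fin.tail g) p : Fin (m + 1) → ℕ) := by
        intro r
        have e : Function.update g 0 p = (Fin.cons p (Fin.tail g) : Fin (m + 1) → ℕ) := by
          funext k
          refine Fin.cases ?_ (fun k => ?_) k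
          · simp
          · simp [Fin.tail]
        have e3 : minorFrom s (m + 1)
          (fun i j => if j = q then (-1) ^ m * r i p else if j = p then 0 else r i j) g =
          minorFrom s (m + 1) (fun i j => if j = q then (-1) ^ m * r i p else r i j) g :=
          minorFrom_congr fun i k _ _ => by
            have := (h0 k).2
            by_cases h : g k = q <;> simp [h, this.ne]
        rw [e3, minorFrom_update (r := r) hg 0 0 p ((-1) ^ m) (by intros; simp [hq])
          (by intros; simp_all), e, minorFrom_snoc]
        simp
      rw [key, key]
      refine H _ ?_
      intro i j hij
      obtain ⟨i, rfl⟩ := Fin.exists_castSucc_eq.2 (Fin.ne_last_of_lt hij)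
      refine Fin.lastCases ?_ (fun j hij => ?_) j hij
      · intro _
        simpa [Fin.tail] using (h0 i.succ).2
      · simpa [Fin.tail] using hg (Fin.succ_lt_succ_iff.2 (Fin.castSucc_lt_castSucc_iff.1 hij))
    · have hne : ∀ k, g k ≠ q := by
        intro k hk
        have := hg.monotone (Fin.zero_le k)
        have := (h0 0).1
        omega
      have hne' : ∀ k, g k ≠ p := fun k => (h0 k).2.ne
      have key : ∀ r : ℕ → ℕ → ℝ, minorFrom s (m + 1)
          (fun i j => if j = q then (-1) ^ m * r i p else if j = p then 0 else r i j) g =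
          minorFrom s (m + 1) r g :=
        fun r => minorFrom_congr fun i j _ _ => by simp [hne j, hne' j]
      rw [key r, key r']
      exact H g hg

end SamePositroid

/-- The unit row `c` joined to the rows of `R`, before a chord is inserted. -/
def rightPart (c a h q : ℕ) (R : ℕ → ℕ → ℝ) (i j : ℕ) : ℝ :=
  if i = c then
    if j = 4 * a + 6 then 1 else if j = 4 * h + 8 ∨ j = 4 * h + 9 then (-1) ^ q else 0
  else if j = 4 * a + 6 then R i 0
  else if 4 ∣ j ∧ 4 * a + 8 ≤ j ∧ j ≤ 4 * h + 8 then R i (j / 4 - 1) else 0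

/-- The rows of `L` placed around the columns of `rightPart`. -/
def leftPart (c a h q : ℕ) (L R : ℕ → ℕ → ℝ) (i j : ℕ) : ℝ :=
  if i < c then
    if j = 4 * a + 6 then L i (a + 1)
    else if 4 ∣ j ∧ 4 ≤ j ∧ j ≤ 4 * a + 4 then L i (j / 4 - 1) else 0
  else rightPart c a h q R i j

/-- The insertion of a chord with index `c`, tail `a` and head `h` and with coefficients
`A`, `B`, `G`, `Δ`, `E` between the `p` rows of `L` and the `q` rows of `R`. -/
def glue (c a h p q : ℕ) (A B G Δ E : ℝ) (L R : ℕ → ℕ → ℝ) (i j : ℕ) : ℝ :=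
  if i < c then
    if j < a then L i j else if j = a then L i a + A * L i (a + 1)
    else if j = a + 1 then B * L i (a + 1) else 0
  else if i = c then
    if j = 0 then (-1) ^ p * E else if j = a then A else if j = a + 1 then B
    else if j = h then (-1) ^ q * G else if j = h + 1 then (-1) ^ q * Δ else 0
  else
    if j = a then A * R i 0 else if j = a + 1 then R i (a + 1) + B * R i 0
    else if a + 1 < j ∧ j < h then R i j else if j = h then R i h + G * R i (h + 1)
    else if j = h + 1 then Δ * R i (h + 1) else 0

theorem samePositroid_rightPart {c a h q : ℕ} {R R' : ℕ → ℕ → ℝ} (hah : a + 2 ≤ h)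
    (H : SamePositroid (c + 1) q R R') :
    SamePositroid c (q + 1) (rightPart c a h q R) (rightPart c a h q R') := by
  have h1 := H.pullback (fun j => j = 4 * a + 6 ∨ (4 ∣ j ∧ 4 * a + 8 ≤ j ∧ j ≤ 4 * h + 8))
    (fun j => if j = 4 * a + 6 then 0 else j / 4 - 1) (by
      intro j j' hj hj' hjj
      split_ifs <;> omega)
  set u : (ℕ → ℕ → ℝ) → ℕ → ℕ → ℝ := fun R i j =>
    if i = c then if j = 4 * a + 5 then 1 else 0
    else if j = 4 * a + 6 ∨ (4 ∣ j ∧ 4 * a + 8 ≤ j ∧ j ≤ 4 * h + 8) then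
      R i (if j = 4 * a + 6 then 0 else j / 4 - 1) else 0 with hu
  have h2 : SamePositroid c 1 (u R) (u R') := by
    intro g _
    have key : ∀ R, minorFrom c 1 (u R) g = if g 0 = 4 * a + 5 then 1 else 0 := by
      intro R
      simp [minorFrom, hu]
    rw [key, key]
    split_ifs
    · exact Or.inl ⟨one_pos, one_pos⟩
    · exact SamePos.zero
  have h3 : SamePositroid c (1 + q) (u R) (u R') := by
    refine h2.directSum (4 * a + 6)
      (h1.congr (fun i j hi _ => by simp [hu, show i ≠ c by omega])
        (fun i j hi _ => by simp [hu, show i ≠ c by omega])) ?_ ?_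
    · intro i j h1 h2 h3
      grind
    · intro i j h1 h2 h3
      grind
  rw [add_comm 1 q] at h3
  have h4 := h3.addCol (4 * a + 5) (4 * a + 6) one_pos one_pos (by omega) (by intros; omega)
  have h5 := h4.moveToBack (4 * a + 5) (4 * h + 9) (by omega) (by grind)
  have h6 := h5.addCol (4 * h + 9) (4 * h + 8) one_pos one_pos (by omega) (by intros; omega)
  refine h6.congr (fun i j _ _ => ?_) (fun i j _ _ => ?_)
  · simp only [hu, rightPart]
    grind
  · simp only [hu, rightPart]
    grind

theorem samePositroid_leftPart {s c a h p q : ℕ} {L L' R R' : ℕ → ℕ → ℝ} (hc : s + p = c)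
    (hah : a + 2 ≤ h) (HL : SamePositroid s p L L') (HR : SamePositroid (c + 1) q R R') :
    SamePositroid s (p + q + 1) (leftPart c a h q L R) (leftPart c a h q L' R') := by
  have h1 := HL.pullback (fun j => 4 ∣ j ∧ 4 ≤ j ∧ j ≤ 4 * a + 4 ∨ j = 4 * a + 5)
    (fun j => if j = 4 * a + 5 then a + 1 else j / 4 - 1) (by
      intro j j' hj hj' hjj
      split_ifs <;> omega)
  have h2 := samePositroid_rightPart hah HR
  set u : (ℕ → ℕ → ℝ) → (ℕ → ℕ → ℝ) → ℕ → ℕ → ℝ := fun L R i j =>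
    if i < c then if 4 ∣ j ∧ 4 ≤ j ∧ j ≤ 4 * a + 4 ∨ j = 4 * a + 5 then
      L i (if j = 4 * a + 5 then a + 1 else j / 4 - 1) else 0
    else rightPart c a h q R i j with hu
  have h3 : SamePositroid s (p + (q + 1)) (u L R) (u L' R') := by
    refine SamePositroid.directSum (4 * a + 6)
      (h1.congr (fun i j _ hi => by simp [hu, show i < c by omega])
        (fun i j _ hi => by simp [hu, show i < c by omega]))
      (hc ▸ h2.congr (fun i j hi _ => by simp [hu, show ¬ i < c by omega])
        (fun i j hi _ => by simp [hu, show ¬ i < c by omega])) ?_ ?_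
    · intro i j _ _ _
      grind
    · intro i j _ _ _
      simp only [hu, rightPart]
      grind
  rw [← add_assoc] at h3
  have h4 := h3.addCol (4 * a + 5) (4 * a + 6) one_pos one_pos (by omega) (by intros; omega)
  have h5 := h4.pullback (fun j => j ≠ 4 * a + 5) id (fun _ _ _ _ h => h)
  refine h5.congr (fun i j _ _ => ?_) (fun i j _ _ => ?_)
  · simp only [hu, leftPart, rightPart, id]
    grind
  · simp only [hu, leftPart, rightPart, id]
    grind

/-- The columns of `w` at `4 j + 4`, into which the three auxiliary columns have been merged. -/
def mergeCols (a h m : ℕ) (A B G Δ E : ℝ) (w : ℕ → ℕ → ℝ) (i j : ℕ) : ℝ :=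
  if j = 0 then w i 4 + E * ((-1) ^ m * w i (4 * h + 9))
  else if j = a then w i (4 * a + 4) + A * w i (4 * a + 6)
  else if j = a + 1 then w i (4 * a + 8) + B * w i (4 * a + 6)
  else if j = h then w i (4 * h + 4) + G * w i (4 * h + 8)
  else if j = h + 1 then Δ * w i (4 * h + 8) else w i (4 * j + 4)

theorem samePositroid_mergeCols {s a h m : ℕ} {A B G Δ E A' B' G' Δ' E' : ℝ}
    {w w' : ℕ → ℕ → ℝ} (ha : 1 ≤ a) (hah : a + 2 ≤ h)
    (hA : 0 < A) (hB : 0 < B) (hG : 0 < G) (hΔ : 0 < Δ) (hE : 0 < E)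
    (hA' : 0 < A') (hB' : 0 < B') (hG' : 0 < G') (hΔ' : 0 < Δ') (hE' : 0 < E')
    (H : SamePositroid s (m + 1) w w')
    (hw : ∀ i j, j ≠ 4 * a + 6 → j ≠ 4 * h + 9 → ¬ (4 ∣ j ∧ 4 ≤ j ∧ j ≤ 4 * h + 8) →
      w i j = 0 ∧ w' i j = 0) :
    SamePositroid s (m + 1) (mergeCols a h m A B G Δ E w) (mergeCols a h m A' B' G' Δ' E' w') := by
  have h1 := H.addCol (4 * a + 6) (4 * a + 4) hA hA' (by omega) (by
    intro i j _ _ _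
    exact hw i j (by omega) (by omega) (by omega))
  have h2 := h1.addCol (4 * a + 6) (4 * a + 8) hB hB' (by omega) (by
    intro i j _ _ _
    simpa [show j ≠ 4 * a + 4 by omega] using hw i j (by omega) (by omega) (by omega))
  have h3 := h2.addCol (4 * h + 8) (4 * h + 4) hG hG' (by omega) (by
    intro i j _ _ _
    simpa [show j ≠ 4 * a + 4 by omega, show j ≠ 4 * a + 8 by omega] using
      hw i j (by omega) (by omega) (by omega))
  have h4 := h3.scaleCol (4 * h + 8) hΔ hΔ'
  have h5 := h4.moveToFront (4 * h + 9) 0 (by omega) (by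
    intro i j _ _ _
    simpa [show j ≠ 4 * a + 4 by omega, show j ≠ 4 * a + 8 by omega,
      show j ≠ 4 * h + 4 by omega, show j ≠ 4 * h + 8 by omega] using
      hw i j (by omega) (by omega) (by omega))
  have h6 := h5.addCol 0 4 hE hE' (by omega) (by
    intro i j _ _ _
    simpa [show j ≠ 4 * a + 4 by omega, show j ≠ 4 * a + 8 by omega, show j ≠ 0 by omega,
      show j ≠ 4 * h + 9 by omega, show j ≠ 4 * h + 4 by omega, show j ≠ 4 * h + 8 by omega] using
      hw i j (by omega) (by omega) (by omega))
  have h7 := h6.pullback (fun _ => True) (fun j => 4 * j + 4) (by intros; omega)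
  clear h1 h2 h3 h4 h5 h6
  refine h7.congr (fun i j _ _ => ?_) (fun i j _ _ => ?_) <;>
  · clear hw H h7
    simp only [mergeCols, if_true]
    by_cases e0 : j = 0
    · subst e0; grind
    by_cases e1 : j = a
    · subst e1; grind
    by_cases e2 : j = a + 1
    · subst e2; grind
    by_cases e3 : j = h
    · subst e3; grind
    by_cases e4 : j = h + 1
    · subst e4; grind
    grind

theorem samePositroid_glue {s c a h p q : ℕ} {A B G Δ E A' B' G' Δ' E' : ℝ}
    {L L' R R' : ℕ → ℕ → ℝ} (hc : s + p = c) (ha : 1 ≤ a) (hah : a + 2 ≤ h)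
    (hA : 0 < A) (hB : 0 < B) (hG : 0 < G) (hΔ : 0 < Δ) (hE : 0 < E)
    (hA' : 0 < A') (hB' : 0 < B') (hG' : 0 < G') (hΔ' : 0 < Δ') (hE' : 0 < E')
    (HL : SamePositroid s p L L') (HR : SamePositroid (c + 1) q R R') :
    SamePositroid s (p + q + 1) (glue c a h p q A B G Δ E L R)
      (glue c a h p q A' B' G' Δ' E' L' R') := by
  have h1 := samePositroid_mergeCols ha hah hA hB hG hΔ hE hA' hB' hG' hΔ' hE'
    (samePositroid_leftPart hc hah HL HR) (by
      intro i j h1 h2 h3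
      simp only [leftPart, rightPart]
      grind)
  have hs : ((-1 : ℝ) ^ (p + q)) * (-1) ^ q = (-1) ^ p := by
    rw [pow_add, mul_assoc, ← mul_pow]; simp
  refine h1.congr (fun i j _ _ => ?_) (fun i j _ _ => ?_) <;>
  · clear h1 HL HR
    have h4 : (4 * j + 4) / 4 - 1 = j := by omega
    simp only [glue, mergeCols, leftPart, rightPart]
    rcases lt_trichotomy i c with hi | hi | hi
    · simp only [hi]
      grind
    · simp only [hi]
      grind
    · simp only [hi.not_gt, hi.ne']
      grind

/-- The rows `s, …, s + m - 1` of `r` are linearly independent already on the columns `tail l`. -/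
def TailIndep (tail : ℕ → ℕ) (s m : ℕ) (r : ℕ → ℕ → ℝ) : Prop :=
  ∀ x : ℕ → ℝ, (∀ l, s ≤ l → l < s + m → ∑ i ∈ Finset.Ico s (s + m), x i * r i (tail l) = 0) →
    ∀ i, s ≤ i → i < s + m → x i = 0

theorem tailIndep_glue {tail : ℕ → ℕ} {s c h p q : ℕ} {A B G Δ E : ℝ} {L R : ℕ → ℕ → ℝ}
    (hc : s + p = c) (ha : 1 ≤ tail c) (hah : tail c + 2 ≤ h) (hA : A ≠ 0)
    (htL : ∀ l, s ≤ l → l < c → tail l < tail c ∧ tail l ≠ 0)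
    (htR : ∀ l, c < l → l < c + 1 + q → tail c < tail l ∧ tail l < h)
    (HL : TailIndep tail s p L) (HR : TailIndep tail (c + 1) q R) :
    TailIndep tail s (p + q + 1) (glue c (tail c) h p q A B G Δ E L R) := by
  intro x hx
  have hsplit : ∀ f : ℕ → ℝ, ∑ i ∈ Finset.Ico s (s + (p + q + 1)), f i =
      ∑ i ∈ Finset.Ico s c, f i + (f c + ∑ i ∈ Finset.Ico (c + 1) (c + 1 + q), f i) := by
    intro f
    rw [← Finset.sum_Ico_consecutive f (show s ≤ c by omega) (by omega),
      Finset.sum_eq_sum_Ico_succ_bot (show c < s + (p + q + 1) by omega),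
      show s + (p + q + 1) = c + 1 + q by omega]
  have hL : ∀ i, s ≤ i → i < c → x i = 0 := by
    subst hc
    refine HL x fun l h1 h2 => ?_
    have h3 := hx l h1 (by omega)
    have h4 := htL l h1 h2
    rw [hsplit] at h3
    rw [Finset.sum_congr rfl (g := fun i => x i * L i (tail l)) (fun i hi => by
        rw [Finset.mem_Ico] at hi
        simp [glue, hi.2, h4.1]),
      Finset.sum_eq_zero (s := Finset.Ico (s + p + 1) _) (fun i hi => by
        rw [Finset.mem_Ico] at hi
        simp only [glue]
        grind)] at h3
    simpa [glue, h4.1.ne, h4.2, show tail l ≠ tail (s + p) + 1 by omega,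
      show tail l ≠ h by omega, show tail l ≠ h + 1 by omega] using h3
  have hLs : ∀ g : ℕ → ℝ, ∑ i ∈ Finset.Ico s c, x i * g i = 0 := fun g =>
    Finset.sum_eq_zero fun i hi => by
      rw [Finset.mem_Ico] at hi
      rw [hL i hi.1 hi.2, zero_mul]
  have hca : x c + ∑ i ∈ Finset.Ico (c + 1) (c + 1 + q), x i * R i 0 = 0 := by
    have h3 := hx c (by omega) (by omega)
    rw [hsplit, hLs, Finset.sum_congr rfl (g := fun i => A * (x i * R i 0)) (fun i hi => by
        rw [Finset.mem_Ico] at hi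
        simp [glue, show ¬ i < c by omega, show i ≠ c by omega]
        ring), ← Finset.mul_sum] at h3
    have h4 : glue c (tail c) h p q A B G Δ E L R c (tail c) = A := by
      simp [glue, show tail c ≠ 0 by omega]
    rw [h4] at h3
    have : A * (x c + ∑ i ∈ Finset.Ico (c + 1) (c + 1 + q), x i * R i 0) = 0 := by linarith
    exact (mul_eq_zero.1 this).resolve_left hA
  have hR : ∀ i, c + 1 ≤ i → i < c + 1 + q → x i = 0 := by
    refine HR x fun l h1 h2 => ?_
    have h3 := hx l (by omega) (by omega)
    have h4 := htR l h1 h2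
    rw [hsplit, hLs] at h3
    by_cases hl : tail l = tail c + 1
    · rw [Finset.sum_congr rfl
        (g := fun i => x i * R i (tail l) + B * (x i * R i 0)) (fun i hi => by
          rw [Finset.mem_Ico] at hi
          simp [glue, show ¬ i < c by omega, show i ≠ c by omega, hl]
          ring), Finset.sum_add_distrib, ← Finset.mul_sum] at h3
      have h5 : glue c (tail c) h p q A B G Δ E L R c (tail l) = B := by
        simp [glue, hl]
      rw [h5] at h3
      linear_combination h3 - B * hca
    · rw [Finset.sum_congr rfl (g := fun i => x i * R i (tail l)) (fun i hi => by
          rw [Finset.mem_Ico] at hi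
          simp [glue, show ¬ i < c by omega, show i ≠ c by omega, hl, h4.1.ne', h4.2,
            show tail c + 1 < tail l by omega])] at h3
      have h5 : glue c (tail c) h p q A B G Δ E L R c (tail l) = 0 := by
        simp [glue, hl, h4.1.ne', h4.2.ne, show tail l ≠ 0 by omega,
          show tail l ≠ h + 1 by omega]
      rw [h5] at h3
      simpa using h3
  intro i h1 h2
  rcases lt_trichotomy i c with hi | rfl | hi
  · exact hL i h1 hi
  · rw [Finset.sum_eq_zero (fun j hj => by
      rw [Finset.mem_Ico] at hj
      rw [hR j hj.1 hj.2, zero_mul])] at hca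
    simpa using hca
  · exact hR i hi (by omega)

/-- The absolute values of the domino variables of chords indexed by natural numbers. -/
structure DominoVars where
  (α β γ δ ε : ℕ → ℝ)

/-- Chord `m` is the parent of chord `l`. -/
def IsPar (head : ℕ → ℕ) (m l : ℕ) : Prop :=
  m < l ∧ head l ≤ head m ∧ ∀ x, m < x → x < l → head x < head l

/-- The starting domino of chord `m`. -/
def startDomino (tail : ℕ → ℕ) (α β : ℕ → ℝ) (m j : ℕ) : ℝ :=
  (if j = tail m then α m else 0) + (if j = tail m + 1 then β m else 0)

/-- The signed starting domino of the parent of chord `l` among the chords from `s` on; a top chord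
has the unit vector at the marker `0` in place of it. -/
def parentDomino (tail head : ℕ → ℕ) (α β : ℕ → ℝ) (s l j : ℕ) : ℝ :=
  (if (∀ m, s ≤ m → m < l → head m < head l) ∧ j = 0 then (-1) ^ (l - s) else 0) +
    ∑ m ∈ Finset.Ico s l, if IsPar head m l then
      (-1) ^ (l - m - 1) * startDomino tail α β m j else 0

/-- The number of descendants of chord `l` among the chords before `e`. -/
def numBelow (head : ℕ → ℕ) (e l : ℕ) : ℕ :=
  ((Finset.Ico (l + 1) e).filter fun x => head x ≤ head l).card

/-- The domino row of chord `l` in the diagram of the chords `s, …, e - 1`, with the last marker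
moved to the marker `0`. -/
def dominoRow (tail head : ℕ → ℕ) (s e : ℕ) (V : DominoVars) (l j : ℕ) : ℝ :=
  startDomino tail V.α V.β l j +
    (-1) ^ numBelow head e l * ((if j = head l then V.γ l else 0) +
      (if j = head l + 1 then V.δ l else 0)) +
    V.ε l * parentDomino tail head V.α V.β s l j

/-- The chords `s, …, e - 1` form a chord diagram. -/
structure IsDiagram (tail head : ℕ → ℕ) (s e : ℕ) : Prop where
  pos : ∀ l, s ≤ l → l < e → 1 ≤ tail l
  lt : ∀ l m, s ≤ l → l < m → m < e → tail l < tail m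
  le : ∀ l, s ≤ l → l < e → tail l + 2 ≤ head l
  nc : ∀ l m, s ≤ l → l < m → m < e → tail m < head l → head m ≤ head l

/-- The inequalities between the domino variables of the chords `s, …, e - 1`. -/
structure DominoVars.Valid (tail head : ℕ → ℕ) (s e : ℕ) (V : DominoVars) : Prop where
  α : ∀ l, s ≤ l → l < e → 0 < V.α l
  β : ∀ l, s ≤ l → l < e → 0 < V.β l
  γ : ∀ l, s ≤ l → l < e → 0 < V.γ l
  δ : ∀ l, s ≤ l → l < e → 0 < V.δ l
  ε : ∀ l, s ≤ l → l < e → 0 < V.ε l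
  sameHead : ∀ l m, s ≤ m → m < l → l < e → head l = head m → V.δ l * V.γ m < V.δ m * V.γ l
  headTail : ∀ l m, s ≤ l → l < e → s ≤ m → m < e → head m = tail l →
    V.δ m * V.α l < V.β l * V.γ m

/-- The variables of the chords before `c`, with the start of `c` as their last marker. -/
def DominoVars.left (tail head : ℕ → ℕ) (c : ℕ) (V : DominoVars) : DominoVars where
  α := V.α
  β := V.β
  γ l := if head l = tail c then V.γ l - V.δ l * V.α c / V.β c else V.γ l
  δ l := if head l = tail c then V.δ l / V.β c else V.δ l
  ε := V.ε

/-- The variables of the chords below `c`, with the end of `c` as their last marker. -/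
def DominoVars.right (head : ℕ → ℕ) (c : ℕ) (V : DominoVars) : DominoVars where
  α := V.α
  β := V.β
  γ l := if head l = head c then V.γ l - V.γ c * V.δ l / V.δ c else V.γ l
  δ l := if head l = head c then V.δ l / V.δ c else V.δ l
  ε := V.ε

section Parent

variable {tail head : ℕ → ℕ} {α β : ℕ → ℝ} {s l : ℕ}

theorem parentDomino_of_top (h : ∀ m, s ≤ m → m < l → head m < head l) (j : ℕ) :
    parentDomino tail head α β s l j = if j = 0 then (-1) ^ (l - s) else 0 := by
  rw [parentDomino, Finset.sum_eq_zero (fun m hm => ?_), add_zero]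
  · simp only [and_iff_right h]
  · rw [Finset.mem_Ico] at hm
    refine if_neg fun hp => ?_
    exact (h m hm.1 hm.2).not_ge hp.2.1

theorem IsPar.unique {m m' : ℕ} (h : IsPar head m l) (h' : IsPar head m' l) : m = m' := by
  by_contra hne
  rcases lt_or_gt_of_ne hne with hlt | hlt
  · exact (h.2.2 m' hlt h'.1).not_ge h'.2.1
  · exact (h'.2.2 m hlt h.1).not_ge h.2.1

theorem parentDomino_of_isPar {m : ℕ} (hm : s ≤ m) (h : IsPar head m l) (j : ℕ) :
    parentDomino tail head α β s l j = (-1) ^ (l - m - 1) * startDomino tail α β m j := by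
  have h1 : ¬ ∀ m, s ≤ m → m < l → head m < head l := fun hh => (hh m hm h.1).not_ge h.2.1
  rw [parentDomino, Finset.sum_eq_single m (fun m' _ hne => if_neg fun hp => hne (hp.unique h))
    (fun hn => absurd (Finset.mem_Ico.2 ⟨hm, h.1⟩) hn)]
  simp [h1, h]

theorem top_or_exists_isPar (head : ℕ → ℕ) (s l : ℕ) :
    (∀ m, s ≤ m → m < l → head m < head l) ∨ ∃ m, s ≤ m ∧ IsPar head m l := by
  by_cases h : ∃ m, s ≤ m ∧ m < l ∧ head l ≤ head m
  · right
    obtain ⟨m, hm, hmax⟩ := ((Finset.range l).filter fun m => s ≤ m ∧ head l ≤ head m).exists_max_image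
      id (by
        obtain ⟨m, h1, h2, h3⟩ := h
        exact ⟨m, by simp [h1, h2, h3]⟩)
    simp only [Finset.mem_filter, Finset.mem_range, id] at hm hmax
    refine ⟨m, hm.2.1, hm.1, hm.2.2, fun x hx hxl => ?_⟩
    by_contra hcon
    have := hmax x ⟨hxl, by omega, by omega⟩
    omega
  · left
    intro m h1 h2
    by_contra hcon
    exact h ⟨m, h1, h2, by omega⟩

end Parent

theorem DominoVars.Valid.left {tail head : ℕ → ℕ} {s c e : ℕ} {V : DominoVars}
    (hV : V.Valid tail head s e) (hs : s ≤ c) (hc : c < e)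
    (hD : IsDiagram tail head s e) :
    (V.left tail head c).Valid tail head s c := by
  have hβ := hV.β c hs hc
  have hα := hV.α c hs hc
  have hγ : ∀ l, s ≤ l → l < c → head l = tail c → 0 < V.γ l - V.δ l * V.α c / V.β c := by
    intro l h1 h2 h3
    have := hV.headTail c l hs hc h1 (by omega) h3
    rw [sub_pos, div_lt_iff₀ hβ]
    linarith
  refine ⟨fun l h1 h2 => hV.α l h1 (by omega), fun l h1 h2 => hV.β l h1 (by omega), ?_, ?_,
    fun l h1 h2 => hV.ε l h1 (by omega), ?_, ?_⟩
  · intro l h1 h2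
    simp only [DominoVars.left]
    split_ifs with h3
    · exact hγ l h1 h2 h3
    · exact hV.γ l h1 (by omega)
  · intro l h1 h2
    have := hV.δ l h1 (by omega)
    simp only [DominoVars.left]
    split_ifs
    · positivity
    · exact this
  · intro l m h1 h2 h3 h4
    have h5 := hV.sameHead l m h1 h2 (by omega) h4
    simp only [DominoVars.left, h4]
    split_ifs
    · have : 0 < (V.δ m * V.γ l - V.δ l * V.γ m) / V.β c := div_pos (by linarith) hβ
      rw [← sub_pos]
      convert this using 1
      ring
    · exact h5
  · intro l m h1 h2 h3 h4 h5
    have h6 := hV.headTail l m h1 (by omega) h3 (by omega) h5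
    have h7 := hD.lt l c h1 h2 hc
    simpa [DominoVars.left, show head m ≠ tail c by omega] using h6

theorem DominoVars.Valid.right {tail head : ℕ → ℕ} {s c e : ℕ} {V : DominoVars}
    (hV : V.Valid tail head s e) (hs : s ≤ c) (hc : c < e)
    (hD : IsDiagram tail head s e) (hh : ∀ l, c < l → l < e → head l ≤ head c) :
    (V.right head c).Valid tail head (c + 1) e := by
  have hδ := hV.δ c hs hc
  have hγ : ∀ l, c < l → l < e → head l = head c → 0 < V.γ l - V.γ c * V.δ l / V.δ c := by
    intro l h1 h2 h3
    have := hV.sameHead l c hs h1 h2 h3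
    rw [sub_pos, div_lt_iff₀ hδ]
    linarith
  refine ⟨fun l h1 h2 => hV.α l (by omega) h2, fun l h1 h2 => hV.β l (by omega) h2, ?_, ?_,
    fun l h1 h2 => hV.ε l (by omega) h2, ?_, ?_⟩
  · intro l h1 h2
    simp only [DominoVars.right]
    split_ifs with h3
    · exact hγ l h1 h2 h3
    · exact hV.γ l (by omega) h2
  · intro l h1 h2
    have := hV.δ l (by omega) h2
    simp only [DominoVars.right]
    split_ifs
    · positivity
    · exact this
  · intro l m h1 h2 h3 h4
    have h5 := hV.sameHead l m (by omega) h2 h3 h4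
    simp only [DominoVars.right, h4]
    split_ifs
    · have : 0 < (V.δ m * V.γ l - V.δ l * V.γ m) / V.δ c := div_pos (by linarith) hδ
      rw [← sub_pos]
      convert this using 1
      ring
    · exact h5
  · intro l m h1 h2 h3 h4 h5
    have h6 := hV.headTail l m (by omega) h2 (by omega) h4 h5
    have h7 := hD.le l (by omega) h2
    have h8 := hh l h1 h2
    simpa [DominoVars.right, show head m ≠ head c by omega] using h6

theorem dominoRow_eq_glue {tail head : ℕ → ℕ} {s c p q : ℕ} {V : DominoVars} (hc : s + p = c)
    (hD : IsDiagram tail head s (c + 1 + q)) (hβ : V.β c ≠ 0) (hδ : V.δ c ≠ 0)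
    (hL : ∀ l, s ≤ l → l < c → head l ≤ tail c)
    (hR : ∀ l, c < l → l < c + 1 + q → head l ≤ head c)
    {i : ℕ} (hi : s ≤ i) (hi' : i < c + 1 + q) (j : ℕ) :
    dominoRow tail head s (c + 1 + q) V i j =
      glue c (tail c) (head c) p q (V.α c) (V.β c) (V.γ c) (V.δ c) (V.ε c)
        (dominoRow tail head s c (V.left tail head c))
        (dominoRow tail head (c + 1) (c + 1 + q) (V.right head c)) i j := by
  have hac := hD.pos c (by omega) (by omega)
  have hhc := hD.le c (by omega) (by omega)
  rcases lt_trichotomy i c with hic | rfl | hic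
  · have hn : numBelow head (c + 1 + q) i = numBelow head c i := by
      unfold numBelow
      congr 1
      ext x
      simp only [Finset.mem_filter, Finset.mem_Ico]
      constructor
      · rintro ⟨⟨h1, h2⟩, h3⟩
        refine ⟨⟨h1, ?_⟩, h3⟩
        by_contra hcx
        have h4 := hL i hi hic
        have h5 := hD.le x (by omega) h2
        have h6 : tail c ≤ tail x := by
          rcases (not_lt.1 hcx).eq_or_lt with rfl | h
          · exact le_rfl
          · exact (hD.lt c x (by omega) h h2).le
        omega
      · rintro ⟨⟨h1, h2⟩, h3⟩
        exact ⟨⟨h1, by omega⟩, h3⟩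
    have hX : ∀ m, s ≤ m → m < c → ∀ j, tail c < j → startDomino tail V.α V.β m j = 0 := by
      intro m h1 h2 j hj
      have := hD.lt m c h1 h2 (by omega)
      simp [startDomino, show j ≠ tail m by omega, show j ≠ tail m + 1 by omega]
    have hY : ∀ j, tail c < j → parentDomino tail head V.α V.β s i j = 0 := by
      intro j hj
      rcases top_or_exists_isPar head s i with h | ⟨m, h1, h2⟩
      · rw [parentDomino_of_top h, if_neg (by omega)]
      · rw [parentDomino_of_isPar h1 h2, hX m h1 (by have := h2.1; omega) j hj, mul_zero]
    have hXi := hX i hi hic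
    have hhi := hL i hi hic
    simp only [dominoRow, glue, DominoVars.left, hn, hic, if_true]
    generalize startDomino tail V.α V.β i = X at *
    generalize parentDomino tail head V.α V.β s i = Y at *
    have hX1 := hXi (tail c + 1) (by omega)
    have hY1 := hY (tail c + 1) (by omega)
    rcases lt_trichotomy j (tail c) with hj | rfl | hj
    · by_cases hh : head i = tail c
      · simp [hj, hj.ne, hh, show j ≠ tail c + 1 by omega]
      · simp [hj, hh]
    · by_cases hh : head i = tail c
      · simp [hh, hX1, hY1]
        field_simp
        ring
      · simp [hh, hX1, hY1, show tail c + 1 ≠ head i by omega, show tail c ≠ head i by omega]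
    · have hXj := hXi j hj
      have hYj := hY j hj
      by_cases hh : head i = tail c
      · by_cases hj1 : j = tail c + 1
        · subst hj1
          simp [hh, hX1, hY1]
          field_simp
        · simp [hh, hXj, hYj, hj1, hj.ne', hj.not_gt]
      · simp [hXj, hYj, hX1, hY1, hj.ne', hj.not_gt, show j ≠ head i by omega,
          show j ≠ head i + 1 by omega, show tail c ≠ head i by omega,
          show tail c + 1 ≠ head i by omega]
  · have hn : numBelow head (i + 1 + q) i = q := by
      unfold numBelow
      rw [Finset.filter_true_of_mem (fun x hx => by
        rw [Finset.mem_Ico] at hx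
        exact hR x (by omega) hx.2), Nat.card_Ico]
      omega
    have htop : ∀ m, s ≤ m → m < i → head m < head i := fun m h1 h2 => by
      have := hL m h1 h2
      omega
    simp only [dominoRow, glue, hn, parentDomino_of_top htop, startDomino, lt_irrefl, if_false,
      if_true, show i - s = p by omega]
    split_ifs <;> first | omega | ring
  · have hci : c + 1 ≤ i := hic
    have hai := hD.lt c i (by omega) hic hi'
    have hhi := hD.le i hi hi'
    have hRi := hR i hic hi'
    have hX : ∀ m, c < m → m < c + 1 + q → ∀ j, j ≤ tail c ∨ head c ≤ j →
        startDomino tail V.α V.β m j = 0 := by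
      intro m h1 h2 j hj
      have h3 := hD.lt c m (by omega) h1 h2
      have h4 := hD.le m (by omega) h2
      have h5 := hR m h1 h2
      simp [startDomino, show j ≠ tail m by omega, show j ≠ tail m + 1 by omega]
    have hY : ∀ j, parentDomino tail head V.α V.β s i j =
        parentDomino tail head V.α V.β (c + 1) i 0 * startDomino tail V.α V.β c j +
          if j = 0 then 0 else parentDomino tail head V.α V.β (c + 1) i j := by
      intro j
      rcases top_or_exists_isPar head (c + 1) i with h | ⟨m, h1, h2⟩
      · have hp : IsPar head c i := ⟨hic, hRi, fun x h1 h2 => h x h1 h2⟩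
        rw [parentDomino_of_isPar (by omega) hp, parentDomino_of_top h, parentDomino_of_top h]
        simp [Nat.sub_sub]
      · have hm := h2.1
        rw [parentDomino_of_isPar (by omega) h2, parentDomino_of_isPar h1 h2,
          parentDomino_of_isPar h1 h2, hX m h1 (by omega) 0 (by omega)]
        split_ifs with hj
        · simp [hj, hX m h1 (by omega) 0 (by omega)]
        · simp
    have hYh : ∀ j, head c ≤ j → parentDomino tail head V.α V.β (c + 1) i j = 0 := by
      intro j hj
      rcases top_or_exists_isPar head (c + 1) i with h | ⟨m, h1, h2⟩
      · rw [parentDomino_of_top h, if_neg (by omega)]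
      · have hm := h2.1
        rw [parentDomino_of_isPar h1 h2, hX m h1 (by omega) j (by omega), mul_zero]
    have hYa : ∀ j, j ≠ 0 → j ≤ tail c → parentDomino tail head V.α V.β (c + 1) i j = 0 := by
      intro j hj hjc
      rcases top_or_exists_isPar head (c + 1) i with h | ⟨m, h1, h2⟩
      · rw [parentDomino_of_top h, if_neg hj]
      · have hm := h2.1
        rw [parentDomino_of_isPar h1 h2, hX m h1 (by omega) j (by omega), mul_zero]
    have hXi := hX i hic hi'
    have hXc : ∀ j, startDomino tail V.α V.β c j =
      (if j = tail c then V.α c else 0) + (if j = tail c + 1 then V.β c else 0) := fun j => rfl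
    simp only [dominoRow, glue, DominoVars.right, hY, hic.not_gt, hic.ne', if_false]
    generalize startDomino tail V.α V.β i = X at *
    generalize parentDomino tail head V.α V.β (c + 1) i = Y at *
    generalize (-1 : ℝ) ^ numBelow head (c + 1 + q) i = t
    have hX0 := hXi 0 (by omega)
    simp only [hXc, hX0]
    have hh1 : tail c ≠ head i := by omega
    have hh2 : tail c + 1 ≠ head i := by omega
    have hh3 : tail c ≠ head i + 1 := by omega
    have hh4 : tail c + 1 ≠ head i + 1 := by omega
    have hh5 : 0 ≠ head i := by omega
    have hh6 : tail c ≠ 0 := by omega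
    rcases lt_or_ge j (head c) with hj | hj
    · rcases lt_trichotomy j (tail c) with hja | rfl | hja
      · have hX1 := hXi j (by omega)
        rcases eq_or_ne j 0 with rfl | hj0
        · simp [hX1, hja.ne, hh5, show 0 ≠ head c by omega]
        · simp [hX1, hYa j hj0 (by omega), hja.ne, hj0, hj.ne, show j ≠ tail c + 1 by omega,
            show ¬ tail c + 1 < j by omega, show j ≠ head c + 1 by omega,
            show j ≠ head i by omega, show j ≠ head i + 1 by omega]
      · simp [hXi (tail c) (by omega), hYa (tail c) hh6 le_rfl, hh1, hh3, hh5, hh6]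
        ring
      · by_cases hja1 : j = tail c + 1
        · subst hja1
          simp [hh1, hh2, hh5]
          ring
        · by_cases hh : head i = head c
          · simp [hh, hj, hj.ne, hja.ne', hja1, show j ≠ 0 by omega,
              show j ≠ head c + 1 by omega, show tail c + 1 < j by omega]
          · simp [hh, hj, hja.ne', hja1, show j ≠ 0 by omega,
              show tail c + 1 < j by omega]
    · have hX1 := hXi j (by omega)
      have hX2 := hXi (head c) (by omega)
      have hX3 := hXi (head c + 1) (by omega)
      have hY1 := hYh j hj
      have hY2 := hYh (head c) le_rfl
      have hY3 := hYh (head c + 1) (by omega)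
      have hj1 : j ≠ tail c := by omega
      have hj2 : j ≠ tail c + 1 := by omega
      have hj3 : j ≠ 0 := by omega
      have hj4 : ¬ j < head c := by omega
      have hj5 : head c ≠ 0 := by omega
      have hj6 : head c ≠ tail c := by omega
      by_cases hh : head i = head c
      · rcases eq_or_ne j (head c) with rfl | hjh
        · simp [hh, hX1, hX3, hY1, hY3, hj1, hj2, hj5]
          field_simp
          ring
        · by_cases hjh1 : j = head c + 1
          · subst hjh1
            simp [hh, hX1, hY1, hj1, hj6]
            field_simp
          · simp [hh, hX1, hY1, hj1, hj2, hj3, hj4, hjh, hjh1]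
      · have hh7 : head c ≠ head i := Ne.symm hh
        have hh8 : head c + 1 ≠ head i := by omega
        rcases eq_or_ne j (head c) with rfl | hjh
        · simp [hh, hX1, hX3, hY1, hY3, hj1, hj2, hj5, hh7, hh8]
        · by_cases hjh1 : j = head c + 1
          · subst hjh1
            simp [hX1, hY1, hj1, hj6, hh8, hh7]
          · simp [hX1, hY1, hj1, hj2, hj3, hj4, hjh, hjh1, show j ≠ head i by omega,
              show j ≠ head i + 1 by omega]

theorem IsDiagram.mono {tail head : ℕ → ℕ} {s e s' e' : ℕ} (hD : IsDiagram tail head s e)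
    (hs : s ≤ s') (he : e' ≤ e) : IsDiagram tail head s' e' :=
  ⟨fun l h1 h2 => hD.pos l (by omega) (by omega),
    fun l m h1 h2 h3 => hD.lt l m (by omega) h2 (by omega),
    fun l h1 h2 => hD.le l (by omega) (by omega),
    fun l m h1 h2 h3 => hD.nc l m (by omega) h2 (by omega)⟩

/-- The first of the chords with the largest head splits the other chords into those that end
before it starts and those that lie below it. -/
theorem IsDiagram.exists_split {tail head : ℕ → ℕ} {s e : ℕ} (hD : IsDiagram tail head s e)
    (hse : s < e) : ∃ c, s ≤ c ∧ c < e ∧ (∀ l, s ≤ l → l < c → head l ≤ tail c) ∧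
      ∀ l, c < l → l < e → head l ≤ head c := by
  have hex : ∃ c, s ≤ c ∧ c < e ∧ ∀ l, s ≤ l → l < e → head l ≤ head c := by
    obtain ⟨c, hc, hmax⟩ := (Finset.Ico s e).exists_max_image head ⟨s, by simp [hse]⟩
    simp only [Finset.mem_Ico] at hc hmax
    exact ⟨c, hc.1, hc.2, fun l h1 h2 => hmax l ⟨h1, h2⟩⟩
  obtain ⟨h1, h2, h3⟩ := Nat.find_spec hex
  refine ⟨Nat.find hex, h1, h2, fun l hl hlc => ?_, fun l hl hle => h3 l (by omega) hle⟩
  by_contra hcon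
  have h4 := hD.nc l _ hl hlc h2 (by omega)
  exact Nat.find_min hex hlc ⟨hl, by omega, fun x hx hxe => (h3 x hx hxe).trans h4⟩

theorem samePositroid_and_tailIndep_dominoRow {tail head : ℕ → ℕ} (m : ℕ) :
    ∀ (s : ℕ) (V V' : DominoVars), IsDiagram tail head s (s + m) →
      V.Valid tail head s (s + m) → V'.Valid tail head s (s + m) →
      SamePositroid s m (dominoRow tail head s (s + m) V) (dominoRow tail head s (s + m) V') ∧
      TailIndep tail s m (dominoRow tail head s (s + m) V) := by
  induction m using Nat.strong_induction_on with
  | _ m ih =>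
    intro s V V' hD hV hV'
    rcases Nat.eq_zero_or_pos m with rfl | hm
    · refine ⟨fun g _ => Or.inl (by simp [minorFrom]), fun x _ i h1 h2 => by omega⟩
    obtain ⟨c, hsc, hce, hL, hR⟩ := hD.exists_split (by omega)
    obtain ⟨p, rfl⟩ := Nat.exists_eq_add_of_le hsc
    obtain ⟨q, hq⟩ := Nat.exists_eq_add_of_lt hce
    obtain rfl : m = p + q + 1 := by omega
    have he : s + (p + q + 1) = s + p + 1 + q := by omega
    rw [he] at hD hV hV' hR hce ⊢
    obtain ⟨hL1, hL2⟩ := ih p (by omega) s _ _ (hD.mono le_rfl hce.le) (hV.left hsc hce hD)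
      (hV'.left hsc hce hD)
    obtain ⟨hR1, hR2⟩ := ih q (by omega) (s + p + 1) _ _ (hD.mono (by omega) le_rfl)
      (hV.right hsc hce hD hR) (hV'.right hsc hce hD hR)
    have ha := hD.pos _ hsc hce
    have hah := hD.le _ hsc hce
    have hglue : ∀ W : DominoVars, W.Valid tail head s (s + p + 1 + q) → ∀ i j, s ≤ i →
        i < s + (p + q + 1) → dominoRow tail head s (s + p + 1 + q) W i j = _ :=
      fun W hW i j h1 h2 => dominoRow_eq_glue rfl hD (hW.β _ hsc hce).ne' (hW.δ _ hsc hce).ne'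
        hL hR h1 (by omega) j
    refine ⟨(samePositroid_glue rfl ha hah (hV.α _ hsc hce) (hV.β _ hsc hce) (hV.γ _ hsc hce)
      (hV.δ _ hsc hce) (hV.ε _ hsc hce) (hV'.α _ hsc hce) (hV'.β _ hsc hce) (hV'.γ _ hsc hce)
      (hV'.δ _ hsc hce) (hV'.ε _ hsc hce) hL1 hR1).congr (hglue V hV) (hglue V' hV'), ?_⟩
    have hT := tailIndep_glue (tail := tail) (B := V.β (s + p)) (G := V.γ (s + p))
      (Δ := V.δ (s + p)) (E := V.ε (s + p)) rfl ha hah (hV.α _ hsc hce).ne'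
      (fun l h1 h2 => ⟨hD.lt l _ h1 h2 hce, by have := hD.pos l h1 (by omega); omega⟩)
      (fun l h1 h2 => ⟨hD.lt _ l hsc h1 h2, by
        have := hD.le l (by omega) h2
        have := hR l h1 h2
        omega⟩) hL2 hR2
    intro x hx
    refine hT x fun l h1 h2 => ?_
    rw [← hx l h1 h2]
    refine Finset.sum_congr rfl fun i hi => ?_
    rw [Finset.mem_Ico] at hi
    rw [hglue V hV i _ hi.1 hi.2]

theorem samePositroid_and_tailIndep_dominoRow_zero {tail head : ℕ → ℕ} {k : ℕ} {V V' : DominoVars}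
    (hD : IsDiagram tail head 0 k) (hV : V.Valid tail head 0 k) (hV' : V'.Valid tail head 0 k) :
    SamePositroid 0 k (dominoRow tail head 0 k V) (dominoRow tail head 0 k V') ∧
      TailIndep tail 0 k (dominoRow tail head 0 k V) := by
  simpa only [Nat.zero_add] using samePositroid_and_tailIndep_dominoRow k 0 V V'
    (by simpa only [Nat.zero_add] using hD) (by simpa only [Nat.zero_add] using hV)
    (by simpa only [Nat.zero_add] using hV')

/-- The extension by zero of a family indexed by `Fin k`. -/
def extendNat {M : Type*} [Zero M] {k : ℕ} (f : Fin k → M) (l : ℕ) : M :=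
  if h : l < k then f ⟨l, h⟩ else 0

@[simp]
theorem extendNat_val {M : Type*} [Zero M] {k : ℕ} (f : Fin k → M) (l : Fin k) :
    extendNat f l = f l := by
  simp [extendNat]

theorem eq_neg_one_pow_mul_abs {N : ℕ} {x : ℝ} (h : 0 < (-1) ^ N * x) : x = (-1) ^ N * |x| := by
  rcases neg_one_pow_eq_or ℝ N with e | e <;> rw [e] at h ⊢
  · rw [abs_of_pos (by linarith)]
    ring
  · rw [abs_of_neg (by linarith)]
    ring

theorem div_eq_abs_div_abs {N : ℕ} {x y : ℝ} (hx : 0 < (-1) ^ N * x) (hy : 0 < (-1) ^ N * y) :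
    x / y = |x| / |y| := by
  rw [← abs_div, abs_of_pos]
  have : 0 < ((-1) ^ N * x) / ((-1) ^ N * y) := div_pos hx hy
  rwa [mul_div_mul_left _ _ (pow_ne_zero _ (by norm_num))] at this

namespace ChordDiagram

section Translation

variable {n k : ℕ} (D : ChordDiagram n k)

theorem isDiagram : IsDiagram (extendNat D.tail) (extendNat D.head) 0 k where
  pos l _ h := by
    lift l to Fin k using h
    simpa using D.one_le_tail l
  lt l m _ hlm h := by
    lift m to Fin k using h
    lift l to Fin k using hlm.trans m.2
    simpa using D.tail_strictMono hlm
  le l _ h := by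
    lift l to Fin k using h
    simpa using D.tail_add_two_le_head l
  nc l m _ hlm h := by
    lift m to Fin k using h
    lift l to Fin k using hlm.trans m.2
    have := D.noncrossing l m hlm
    simp only [extendNat_val]
    omega

theorem descendant_iff (l m : Fin k) : D.Descendant l m ↔ l < m ∧ D.head m ≤ D.head l := by
  rw [Descendant, D.tail_strictMono.lt_iff_lt]

theorem isParent_iff (m l : Fin k) : D.IsParent m l ↔ IsPar (extendNat D.head) m l := by
  simp only [IsParent, descendant_iff, IsPar, extendNat_val, Fin.val_fin_lt, and_assoc,
    D.tail_strictMono.le_iff_le]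
  refine and_congr_right fun h1 => and_congr_right fun h2 => ⟨fun h x hmx hxl => ?_,
    fun h x hx => ?_⟩
  · lift x to Fin k using hxl.trans l.2
    by_contra hcon
    exact (h x ⟨hxl, by simpa using hcon⟩).not_gt hmx
  · by_contra hcon
    have := h x (not_le.1 hcon) hx.1
    simp only [extendNat_val] at this
    omega

theorem isTop_iff (l : Fin k) : D.IsTop l ↔
    ∀ m, 0 ≤ m → m < (l : ℕ) → extendNat D.head m < extendNat D.head l := by
  simp only [IsTop, descendant_iff]
  constructor
  · intro h m _ hm
    lift m to Fin k using hm.trans l.2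
    by_contra hcon
    exact h m ⟨hm, by simpa using hcon⟩
  · intro h m hm
    have := h m (Nat.zero_le _) hm.1
    simp only [extendNat_val] at this
    omega

theorem below_eq (l : Fin k) : D.below l = numBelow (extendNat D.head) k l := by
  rw [below, numBelow, ← Finset.card_map Fin.valEmbedding]
  congr 1
  ext x
  simp only [Finset.mem_map, Finset.mem_filter, Finset.mem_univ, true_and, descendant_iff,
    Fin.valEmbedding_apply, Finset.mem_Ico]
  constructor
  · rintro ⟨m, ⟨h1, h2⟩, rfl⟩
    exact ⟨⟨h1, m.2⟩, by simpa using h2⟩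
  · rintro ⟨⟨h1, h2⟩, h3⟩
    lift x to Fin k using h2
    exact ⟨x, ⟨h1, by simpa using h3⟩, rfl⟩

theorem behind_eq (l : Fin k) : D.behind l = k - 1 - l := by
  rw [← Fin.card_Ioi, behind]
  congr 1
  ext m
  simp [D.tail_strictMono.lt_iff_lt]

theorem beyond_eq {l m : Fin k} (h : D.IsParent m l) : D.beyond l m = l - m - 1 := by
  rw [← Fin.card_Ioo, beyond]
  congr 1
  ext x
  rw [isParent_iff] at h
  simp only [Finset.mem_filter, Finset.mem_univ, true_and, descendant_iff, Finset.mem_Ioo,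
    D.tail_strictMono.lt_iff_lt]
  refine ⟨fun hx => ⟨hx.1.1, hx.2⟩, fun hx => ⟨⟨hx.1, ?_⟩, hx.2⟩⟩
  have h1 := h.2.2 x hx.1 hx.2
  have h2 := h.2.1
  simp only [extendNat_val] at h1 h2
  omega

/-- The absolute values of domino variables, indexed by natural numbers. -/
def absVars (α β γ δ ε : Fin k → ℝ) : DominoVars where
  α := extendNat α
  β := extendNat β
  γ := extendNat fun l => |γ l|
  δ := extendNat fun l => |δ l|
  ε := extendNat fun l => |ε l|

variable {D} {α β γ δ ε : Fin k → ℝ}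

theorem isTop_or_exists_isParent (l : Fin k) : D.IsTop l ∨ ∃ m, D.IsParent m l := by
  rcases top_or_exists_isPar (extendNat D.head) 0 l with h | ⟨m, -, h⟩
  · exact Or.inl ((D.isTop_iff l).2 h)
  · have hml := h.1
    lift m to Fin k using hml.trans l.2
    exact Or.inr ⟨m, (D.isParent_iff m l).2 h⟩

theorem SignRules.div_lt_div (hs : D.SignRules α β γ δ ε) (l : Fin k) :
    ∀ m < l, D.head l = D.head m → δ l / γ l < δ m / γ m := by
  obtain ⟨-, -, -, -, -, -, h7, -⟩ := hs
  induction l using WellFoundedLT.induction with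
  | _ l ih =>
    intro m hml hh
    rcases D.isTop_or_exists_isParent l with h | ⟨p, hp⟩
    · exact absurd ((D.descendant_iff m l).2 ⟨hml, hh.le⟩) (h m)
    · have hd := (D.descendant_iff p l).1 hp.1
      have hmp := D.tail_strictMono.le_iff_le.1 (hp.2 m ((D.descendant_iff m l).2 ⟨hml, hh.le⟩))
      rcases hmp.eq_or_lt with rfl | hmp
      · exact h7 l m hp hh
      · have h1 := D.tail_strictMono hd.1
        have h2 := D.tail_add_two_le_head l
        have h3 := D.noncrossing m p hmp
        have h4 : D.head p = D.head m := by omega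
        exact (h7 l p hp (by omega)).trans (ih p hd.1 m hmp h4)

theorem SignRules.valid (hs : D.SignRules α β γ δ ε) :
    (absVars α β γ δ ε).Valid (extendNat D.tail) (extendNat D.head) 0 k := by
  have hd := hs.div_lt_div
  obtain ⟨h1, h2, h3, h4, h5, h6, -, h8⟩ := hs
  have hγ : ∀ l, 0 < |γ l| := fun l => abs_pos.2 fun h => by simpa [h] using h3 l
  have hδ : ∀ l, 0 < |δ l| := fun l => abs_pos.2 fun h => by simpa [h] using h4 l
  have hε : ∀ l, 0 < |ε l| := fun l => abs_pos.2 fun h => by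
    rcases D.isTop_or_exists_isParent l with ht | ⟨p, hp⟩
    · simpa [h] using h5 l ht
    · simpa [h] using h6 l p hp
  refine ⟨fun l _ h => ?_, fun l _ h => ?_, fun l _ h => ?_, fun l _ h => ?_, fun l _ h => ?_,
    fun l m _ hml h hh => ?_, fun l m _ h _ h' hh => ?_⟩
  · lift l to Fin k using h
    simpa [absVars] using h1 l
  · lift l to Fin k using h
    simpa [absVars] using h2 l
  · lift l to Fin k using h
    simpa [absVars] using hγ l
  · lift l to Fin k using h
    simpa [absVars] using hδ l
  · lift l to Fin k using h
    simpa [absVars] using hε l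
  · lift l to Fin k using h
    lift m to Fin k using hml.trans l.2
    have := hd l m hml (by simpa using hh)
    rw [div_eq_abs_div_abs (h4 l) (h3 l), div_eq_abs_div_abs (h4 m) (h3 m),
      div_lt_div_iff₀ (hγ l) (hγ m)] at this
    simpa [absVars] using this
  · lift l to Fin k using h
    lift m to Fin k using h'
    have := h8 l m (by simpa using hh)
    rw [div_eq_abs_div_abs (h4 m) (h3 m), div_lt_div_iff₀ (hγ m) (h1 l)] at this
    simpa [absVars] using this

/-- The matrix `dominoRow` with the marker `0` moved back to the last marker. -/
def movedRow (D : ChordDiagram n k) (V : DominoVars) (l j : ℕ) : ℝ :=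
  if j = n then (-1) ^ (k - 1) * dominoRow (extendNat D.tail) (extendNat D.head) 0 k V l 0
  else if j = 0 then 0 else dominoRow (extendNat D.tail) (extendNat D.head) 0 k V l j

theorem dominoMatrix_apply (hs : D.SignRules α β γ δ ε) (l : Fin k) (a : Fin n) :
    D.dominoMatrix α β γ δ ε l a = D.movedRow (absVars α β γ δ ε) l (a + 1) := by
  obtain ⟨-, -, h3, h4, h5, h6, -, -⟩ := hs
  have ht := D.one_le_tail l
  have hth := D.tail_add_two_le_head l
  have hhn := D.head_add_two_le l
  have hγ := eq_neg_one_pow_mul_abs (h3 l)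
  have hδ := eq_neg_one_pow_mul_abs (h4 l)
  rw [below_eq] at hγ hδ
  simp only [dominoMatrix, movedRow, Matrix.of_apply, Nat.add_eq_zero_iff, one_ne_zero, and_false,
    if_false, dominoRow]
  rcases D.isTop_or_exists_isParent l with htop | ⟨p, hp⟩
  · have hnp : ∀ m, ¬ D.IsParent m l := fun m hm => htop m hm.1
    have hε := eq_neg_one_pow_mul_abs (h5 l htop)
    have hpow : (-1 : ℝ) ^ (k - 1) * (-1) ^ (l : ℕ) = (-1) ^ (k - 1 - (l : ℕ)) := by
      have : k - 1 = k - 1 - l + l := by omega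
      conv_lhs => rw [this]
      rw [pow_add, mul_assoc, ← pow_add, ← two_mul, pow_mul]
      simp
    rw [behind_eq, ← hpow] at hε
    simp only [parentDomino_of_top ((D.isTop_iff l).1 htop), hnp, if_false,
      Finset.sum_const_zero, htop, true_and]
    by_cases han : (a : ℕ) + 1 = n
    · simp [han, startDomino, absVars, show n ≠ D.tail l by omega, show n ≠ D.tail l + 1 by omega,
        show n ≠ D.head l by omega, show n ≠ D.head l + 1 by omega, show 0 ≠ D.tail l by omega,
        show 0 ≠ D.head l by omega]
      linear_combination hε
    · simp only [startDomino, absVars, extendNat_val, han, if_false, Nat.add_eq_zero_iff,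
        one_ne_zero, and_false]
      rw [mul_add, mul_ite, mul_ite, ← hγ, ← hδ]
      ring_nf
  · have hnt : ¬ D.IsTop l := fun h => h p hp.1
    have hpar := (D.isParent_iff p l).1 hp
    have hε := eq_neg_one_pow_mul_abs (h6 l p hp)
    have hpl := D.tail_strictMono ((D.descendant_iff p l).1 hp.1).1
    have hpp := D.one_le_tail p
    rw [D.beyond_eq hp] at hε
    rw [Finset.sum_eq_single p (fun m _ hne => if_neg fun hm => hne
      (Fin.ext (((D.isParent_iff m l).1 hm).unique hpar))) (by simp), if_pos hp]
    simp only [parentDomino_of_isPar (Nat.zero_le _) hpar, hnt, false_and, if_false]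
    by_cases han : (a : ℕ) + 1 = n
    · simp [han, startDomino, absVars, show n ≠ D.tail l by omega, show n ≠ D.tail l + 1 by omega,
        show n ≠ D.head l by omega, show n ≠ D.head l + 1 by omega, show 0 ≠ D.tail l by omega,
        show 0 ≠ D.head l by omega, show n ≠ D.tail p by omega, show n ≠ D.tail p + 1 by omega,
        show 0 ≠ D.tail p by omega]
    · simp only [startDomino, absVars, extendNat_val, han, if_false]
      rw [mul_add (_ ^ numBelow _ _ _), mul_ite, mul_ite, ← hγ, ← hδ, ← mul_assoc, mul_comm |_|,
        ← hε]
      split_ifs <;> ring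

theorem dominoRow_eq_zero (D : ChordDiagram n k) (V : DominoVars) {i j : ℕ} (hi : i < k)
    (hj : n < j) : dominoRow (extendNat D.tail) (extendNat D.head) 0 k V i j = 0 := by
  have hD := D.isDiagram
  have hh : ∀ m < k, extendNat D.head m + 2 ≤ n := fun m hm => by
    lift m to Fin k using hm
    simpa using D.head_add_two_le m
  have hX : ∀ m < k, startDomino (extendNat D.tail) V.α V.β m j = 0 := fun m hm => by
    have h1 := hh m hm
    have h2 := hD.le m (Nat.zero_le _) hm
    rw [startDomino, if_neg (by omega), if_neg (by omega), add_zero]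
  have hY : parentDomino (extendNat D.tail) (extendNat D.head) V.α V.β 0 i j = 0 := by
    rcases top_or_exists_isPar (extendNat D.head) 0 i with h | ⟨m, h1, h2⟩
    · rw [parentDomino_of_top h, if_neg (by omega)]
    · rw [parentDomino_of_isPar h1 h2, hX m (h2.1.trans hi), mul_zero]
  have h1 := hh i hi
  rw [dominoRow, hX i hi, hY, if_neg (by omega), if_neg (by omega)]
  ring

theorem samePos_minorFrom_movedRow {V V' : DominoVars} {g : Fin k → ℕ} (hn : 0 < n)
    (hV : V.Valid (extendNat D.tail) (extendNat D.head) 0 k)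
    (hV' : V'.Valid (extendNat D.tail) (extendNat D.head) 0 k) (hg : StrictMono g) :
    SamePos (minorFrom 0 k (D.movedRow V) g) (minorFrom 0 k (D.movedRow V') g) := by
  have h := (samePositroid_and_tailIndep_dominoRow_zero D.isDiagram hV hV').1
  cases k with
  | zero => exact Or.inl (by simp [minorFrom])
  | succ k =>
    exact h.moveToBack 0 n hn (fun i j _ hi hj => by
      rw [Nat.zero_add] at hi
      have hj : n < j := by omega
      exact ⟨D.dominoRow_eq_zero V hi hj, D.dominoRow_eq_zero V' hi hj⟩) g hg

theorem samePos_det_submatrix {α' β' γ' δ' ε' : Fin k → ℝ} (hn : 0 < n)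
    (hs : D.SignRules α β γ δ ε) (hs' : D.SignRules α' β' γ' δ' ε') {g : Fin k → Fin n}
    (hg : StrictMono g) :
    SamePos ((D.dominoMatrix α β γ δ ε).submatrix id g).det
      ((D.dominoMatrix α' β' γ' δ' ε').submatrix id g).det := by
  have key : ∀ {α β γ δ ε : Fin k → ℝ}, D.SignRules α β γ δ ε →
      ((D.dominoMatrix α β γ δ ε).submatrix id g).det =
        minorFrom 0 k (D.movedRow (absVars α β γ δ ε)) fun j => (g j : ℕ) + 1 := by
    intro α β γ δ ε h
    rw [minorFrom]
    congr 1
    ext i j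
    simp [dominoMatrix_apply h]
  rw [key hs, key hs']
  exact samePos_minorFrom_movedRow hn hs.valid hs'.valid fun i j hij =>
    Nat.add_lt_add_right (hg hij) 1

theorem linearIndependent_dominoMatrix (hs : D.SignRules α β γ δ ε) :
    LinearIndependent ℝ (D.dominoMatrix α β γ δ ε).row := by
  have h := (samePositroid_and_tailIndep_dominoRow_zero D.isDiagram hs.valid hs.valid).2
  rw [Fintype.linearIndependent_iff]
  intro x hx i
  have hx' := h (extendNat x) (fun l _ hl => ?_) i (Nat.zero_le _) (by simp)
  · simpa using hx'
  · rw [Nat.zero_add] at hl ⊢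
    lift l to Fin k using hl
    have h1 := D.one_le_tail l
    have h2 := D.tail_add_two_le_head l
    have h3 := D.head_add_two_le l
    have h4 := congrFun hx ⟨D.tail l - 1, by omega⟩
    rw [Finset.sum_apply, Pi.zero_apply] at h4
    rw [← Finset.range_eq_Ico, Finset.sum_range, ← h4]
    refine Finset.sum_congr rfl fun i _ => ?_
    simp [Matrix.row, dominoMatrix_apply hs, movedRow, Nat.sub_add_cancel h1,
      show D.tail l ≠ n by omega, show D.tail l ≠ 0 by omega]

end Translation

end ChordDiagram

/-- A domino matrix of a chord diagram `D` satisfying the sign rules is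
totally nonnegative of rank `k`, and the vanishing of any of its maximal (`k × k`) minors
depends only on `D` and the column set, not on the choice of variables. -/
theorem dominoMatrix_totallyNonneg_rank_and_minor_vanishing
    (n k : ℕ) (hk : 1 ≤ k) (hn : k + 4 ≤ n)
    (D : ChordDiagram n k) (α β γ δ ε : Fin k → ℝ) (hs : D.SignRules α β γ δ ε) :
    IsTotallyNonnegRect (D.dominoMatrix α β γ δ ε) ∧
    (D.dominoMatrix α β γ δ ε).rank = k ∧
    (∀ α' β' γ' δ' ε' : Fin k → ℝ, D.SignRules α' β' γ' δ' ε' →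
      ∀ I : Finset (Fin n), I.card = k →
        (colMinor (D.dominoMatrix α β γ δ ε) I = 0 ↔
          colMinor (D.dominoMatrix α' β' γ' δ' ε') I = 0)) := by
  have hn' : 0 < n := by omega
  refine ⟨fun g hg => ?_, ?_, fun α' β' γ' δ' ε' hs' I hI => ?_⟩
  · exact (ChordDiagram.samePos_det_submatrix hn' hs hs hg).nonneg
  · rw [(ChordDiagram.linearIndependent_dominoMatrix hs).rank_matrix, Fintype.card_fin]
  · rw [colMinor, colMinor, dif_pos hI, dif_pos hI]
    exact (ChordDiagram.samePos_det_submatrix hn' hs hs' fun i j hij =>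
      (I.orderIsoOfFin hI).strictMono hij).eq_zero_iff

end
end
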